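/- Let G be a non-trivial finitely generated group, and equip the free product G∗ℤ with the finite generating set consisting of a finite generating set of G together with a generator t of the ℤ factor. Then the horofunction boundary ∂_h(G∗ℤ) has no isolated points, and G∗ℤ acts faithfully on ∂_h(G∗ℤ). Furthermore, if G∗ℤ has finitely many types of infinite atoms, then the associated type graph has an irreducible core. -/

import Mathlib

open scoped Classical

noncomputable section

/-- The word length of `g` with respect to a generating set `S` (using letters from
`S ∪ S⁻¹`). -/
def wordLength {G : Type} [Group G] (S : Set G) (g : G) : ℕ :=
  sInf {n | ∃ l : List G, l.length = n ∧ (∀ x ∈ l, x ∈ S ∨ x⁻¹ ∈ S) ∧ l.prod = g}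

/-- The word metric on `G` with respect to `S`. -/
def wordDist {G : Type} [Group G] (S : Set G) (x y : G) : ℕ :=
  wordLength S (x⁻¹ * y)

/-- `p 0, p 1, …, p n` is a geodesic segment for the word metric. -/
def IsGeodesicSeg {G : Type} [Group G] (S : Set G) (p : ℕ → G) (n : ℕ) : Prop :=
  ∀ i j : ℕ, i ≤ j → j ≤ n → wordDist S (p i) (p j) = j - i

/-- The Cayley graph of `G` with respect to `S` is `δ`-hyperbolic: every side of every
geodesic triangle lies in the `δ`-neighborhood of the union of the other two sides. -/
def SlimTriangles {G : Type} [Group G] (S : Set G) (δ : ℝ) : Prop :=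
  ∀ (p q r : ℕ → G) (np nq nr : ℕ),
    IsGeodesicSeg S p np → IsGeodesicSeg S q nq → IsGeodesicSeg S r nr →
    p np = q 0 → q nq = r 0 → r nr = p 0 →
    ∀ i ≤ np, ∃ j : ℕ,
      (j ≤ nq ∧ (wordDist S (p i) (q j) : ℝ) ≤ δ) ∨
      (j ≤ nr ∧ (wordDist S (p i) (r j) : ℝ) ≤ δ)

/-- A group is hyperbolic if it has a finite generating set whose Cayley graph is
`δ`-hyperbolic for some `δ > 0`. -/
def IsHyperbolicGroup (G : Type) [Group G] : Prop :=
  ∃ S : Set G, S.Finite ∧ Subgroup.closure S = ⊤ ∧ ∃ δ : ℝ, 0 < δ ∧ SlimTriangles S δ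

/-- The ball of radius `n` about the identity. -/
def ball {G : Type} [Group G] (S : Set G) (n : ℕ) : Set G :=
  {x | wordLength S x ≤ n}

/-- `x ∼ y` for the ball `B_n`: the function `d_x - d_y` is constant on `B_n`. -/
def SameAtom {G : Type} [Group G] (S : Set G) (n : ℕ) (x y : G) : Prop :=
  ∀ a ∈ ball S n, ∀ b ∈ ball S n,
    (wordDist S x a : ℤ) - (wordDist S y a : ℤ) =
      (wordDist S x b : ℤ) - (wordDist S y b : ℤ)

/-- The atom for `B_n` containing `x`. -/
def atomOf {G : Type} [Group G] (S : Set G) (n : ℕ) (x : G) : Set G :=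
  {y | SameAtom S n x y}

/-- `𝒜_n(G)`: the infinite atoms for `B_n`. -/
def InfAtoms {G : Type} [Group G] (S : Set G) (n : ℕ) : Set (Set G) :=
  {A | (∃ x, A = atomOf S n x) ∧ A.Infinite}

/-- `g` is a morphism from the atom `A₁ ∈ 𝒜_m(G)` to the atom `A₂ ∈ 𝒜_n(G)`. -/
def IsMorphism {G : Type} [Group G] (S : Set G) (g : G) (m : ℕ) (A₁ : Set G)
    (n : ℕ) (A₂ : Set G) : Prop :=
  ((g * ·) '' A₁ = A₂) ∧
  (∀ k : ℕ, (g * ·) '' (A₁ ∩ ball S (m + k)) = A₂ ∩ ball S (n + k)) ∧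
  ∀ k : ℕ, 0 < k → ∀ A' ∈ InfAtoms S (m + k), A' ⊆ A₁ →
    (g * ·) '' A' ∈ InfAtoms S (n + k) ∧ (g * ·) '' A' ⊆ A₂

/-- Two atoms have the same type if there is a morphism between them. -/
def SameType {G : Type} [Group G] (S : Set G) (m : ℕ) (A₁ : Set G) (n : ℕ)
    (A₂ : Set G) : Prop :=
  ∃ g : G, IsMorphism S g m A₁ n A₂

/-- `N(A)`: the set of points of `B_n` at which `d̄_A` attains its minimum, i.e. the set
of nearest neighbors in `B_n` of the points of `A`. -/
def nearestSet {G : Type} [Group G] (S : Set G) (n : ℕ) (A : Set G) : Set G :=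
  {p | p ∈ ball S n ∧ ∀ x ∈ A, ∀ q ∈ ball S n, wordDist S x p ≤ wordDist S x q}
/-- The additive subgroup of constant functions in `G → ℤ`. -/
def constFuns (K : Type) : AddSubgroup (K → ℤ) where
  carrier := {f | ∃ c : ℤ, ∀ y, f y = c}
  zero_mem' := ⟨0, fun _ => rfl⟩
  add_mem' := by
    intro f g hf hg
    obtain ⟨c, hc⟩ := hf
    obtain ⟨d, hd⟩ := hg
    exact ⟨c + d, fun y => by simp [Pi.add_apply, hc y, hd y]⟩
  neg_mem' := by
    intro f hf
    obtain ⟨c, hc⟩ := hf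
    exact ⟨-c, fun y => by simp [Pi.neg_apply, hc y]⟩

/-- `F̄(G,ℤ)`: integer valued functions on `K` modulo constants, with the quotient of
the product topology. -/
abbrev FBar (K : Type) := (K → ℤ) ⧸ constFuns K

/-- The image `d̄_x ∈ F̄(G,ℤ)` of the distance function `d_x = d(x,·)`. -/
def dbar {K : Type} [Group K] (S : Set K) (x : K) : FBar K :=
  QuotientAddGroup.mk (fun y => (wordDist S x y : ℤ))

/-- The horofunction boundary: the set of limit points of `{d̄_x : x ∈ G}` in
`F̄(G,ℤ)`. -/
def horoBoundary {K : Type} [Group K] (S : Set K) : Set (FBar K) :=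
  {φ | φ ∈ closure (Set.range (dbar S) \ {φ})}

/-- Precomposition with left translation by `g⁻¹`, as an additive homomorphism. -/
def translateHom {K : Type} [Group K] (g : K) : (K → ℤ) →+ (K → ℤ) where
  toFun f := fun y => f (g⁻¹ * y)
  map_zero' := rfl
  map_add' _ _ := rfl

/-- The action of `g ∈ G` on `F̄(G,ℤ)` (inducing the action on the horofunction
boundary). -/
def boundaryAct {K : Type} [Group K] (g : K) : FBar K → FBar K :=
  ⇑(QuotientAddGroup.map (constFuns K) (constFuns K) (translateHom g)
    (by
      intro f hf
      obtain ⟨c, hc⟩ := hf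
      exact ⟨c, fun y => hc _⟩))

/-- The shadow `∂A` of an atom `A` for `B_n`: the set of boundary points that agree
with `d̄_A` on `B_n`. -/
def shadowSet {K : Type} [Group K] (S : Set K) (n : ℕ) (A : Set K) : Set (FBar K) :=
  {ψ | ψ ∈ horoBoundary S ∧ ∃ h : K → ℤ, (QuotientAddGroup.mk h : FBar K) = ψ ∧
    ∃ x ∈ A, ∀ a ∈ ball S n, ∀ b ∈ ball S n,
      h a - (wordDist S x a : ℤ) = h b - (wordDist S x b : ℤ)}
/-- A finite directed graph (loops and parallel edges are allowed). -/
structure FinDigraph : Type 1 where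
  V : Type
  E : Type
  [fintypeV : Fintype V]
  [fintypeE : Fintype E]
  o : E → V
  t : E → V

attribute [instance] FinDigraph.fintypeV FinDigraph.fintypeE

instance (Γ : FinDigraph) : TopologicalSpace Γ.E := ⊥
instance (Γ : FinDigraph) : DiscreteTopology Γ.E := ⟨rfl⟩

namespace FinDigraph

variable (Γ : FinDigraph)

/-- The subshift of finite type `Σ_Γ`: the set of all infinite directed paths in `Γ`,
viewed as a subset of the product space of all edge sequences (each edge's terminus is
the origin of the next edge). -/
def shift : Set (ℕ → Γ.E) := {x | ∀ i, Γ.t (x i) = Γ.o (x (i + 1))}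

/-- Validity of a finite directed path starting at a given node. -/
def pathOk : Γ.V → List Γ.E → Prop
  | _, [] => True
  | v, e :: l => Γ.o e = v ∧ pathOk (Γ.t e) l

/-- A finite directed path in `Γ` (a node together with a compatible list of edges;
a path with no edges is a node, regarded as a path of length `0`). -/
structure FinPath where
  start : Γ.V
  edges : List Γ.E
  ok : Γ.pathOk start edges

/-- Terminus of a list of edges starting at a given node. -/
def pathEndAux : Γ.V → List Γ.E → Γ.V
  | v, [] => v
  | _, e :: l => pathEndAux (Γ.t e) l

/-- The terminus `t(α)` of a finite directed path. -/
def pathEnd (α : Γ.FinPath) : Γ.V := Γ.pathEndAux α.start α.edges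

/-- The length-0 path at a node `v`. -/
def trivPath (v : Γ.V) : Γ.FinPath := ⟨v, [], by simp [pathOk]⟩

/-- The cone `C_α ⊆ Σ_Γ` of all infinite directed paths having `α` as a prefix. -/
def cone (α : Γ.FinPath) : Set (ℕ → Γ.E) :=
  {x | x ∈ Γ.shift ∧ Γ.o (x 0) = α.start ∧
    ∀ (i : ℕ) (h : i < α.edges.length), x i = α.edges.get ⟨i, h⟩}

/-- The canonical similarity `C_α → C_β` (for `t(α) = t(β)`) on the level of edge
sequences: delete the prefix `α` and attach the prefix `β`. -/
def splice (α β : Γ.FinPath) (x : ℕ → Γ.E) : ℕ → Γ.E := fun i =>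
  if h : i < β.edges.length then β.edges.get ⟨i, h⟩
  else x (i - β.edges.length + α.edges.length)

/-- Concatenation `α · ω` of a finite path with an infinite path (on sequences). -/
def catPath (α : Γ.FinPath) (x : ℕ → Γ.E) : ℕ → Γ.E :=
  Γ.splice (Γ.trivPath (Γ.pathEnd α)) α x

/-- The length of the path `f̄(α)`, i.e. of the greatest common prefix of all points
of `f(C_α)`. -/
def barLen (f : (ℕ → Γ.E) → ℕ → Γ.E) (α : Γ.FinPath) : ℕ :=
  sSup {n | ∀ x ∈ Γ.cone α, ∀ y ∈ Γ.cone α, ∀ i < n, f x i = f y i}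

/-- The local action `f|_α : C_{t(α)} → C_{t(f̄(α))}`, determined by
`f(α·ω) = f̄(α)·(f|_α)(ω)`.  It is recorded together with the node `t(α)`
(the node of its domain cone), and is extended by the identity off the cone
`C_{t(α)}`. -/
def localAction (f : (ℕ → Γ.E) → ℕ → Γ.E) (α : Γ.FinPath) :
    Γ.V × ((ℕ → Γ.E) → ℕ → Γ.E) :=
  (Γ.pathEnd α, fun w =>
    if w ∈ Γ.cone (Γ.trivPath (Γ.pathEnd α)) then
      fun i => f (Γ.catPath α w) (i + Γ.barLen f α)
    else w)

/-- A map is rational (on a domain `D`) if it has only finitely many distinct local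
actions at cones contained in `D`. -/
def RationalOn (f : (ℕ → Γ.E) → ℕ → Γ.E) (D : Set (ℕ → Γ.E)) : Prop :=
  (Γ.localAction f '' {α : Γ.FinPath | Γ.cone α ⊆ D}).Finite

/-- The nucleus `𝒩_f` of a map: the set of local actions `f|_α` that occur for
infinitely many finite paths `α` with `C_α` contained in the domain. -/
def nucleusOf (f : (ℕ → Γ.E) → ℕ → Γ.E) (D : Set (ℕ → Γ.E)) :
    Set (Γ.V × ((ℕ → Γ.E) → ℕ → Γ.E)) :=
  {p | {α : Γ.FinPath | Γ.cone α ⊆ D ∧ Γ.localAction f α = p}.Infinite}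

/-- A nondegenerate map on `Σ_Γ` with domain `D`: it takes values in `Σ_Γ` and maps no
cone contained in `D` to a single point. -/
def Nondegenerate (f : (ℕ → Γ.E) → ℕ → Γ.E) (D : Set (ℕ → Γ.E)) : Prop :=
  (∀ x ∈ D, f x ∈ Γ.shift) ∧
  ∀ α : Γ.FinPath, Γ.cone α ⊆ D → ¬∃ p, ∀ x ∈ Γ.cone α, f x = p

/-- Extension of a map `E → E'` between subsets of the sequence space to a globally
defined map (by the identity off `E`). -/
def homExt (E E' : Set (ℕ → Γ.E)) (f : ↥E → ↥E') : (ℕ → Γ.E) → ℕ → Γ.E :=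
  fun x => if h : x ∈ E then ↑(f ⟨x, h⟩) else x

/-- Extension of a permutation of `E` to a globally defined map. -/
def permExt (E : Set (ℕ → Γ.E)) (g : Equiv.Perm ↥E) : (ℕ → Γ.E) → ℕ → Γ.E :=
  Γ.homExt E E ⇑g

/-- `E` is a clopen subset of the subshift `Σ_Γ`. -/
def ClopenIn (E : Set (ℕ → Γ.E)) : Prop :=
  IsClopen {x : ↥Γ.shift | (x : ℕ → Γ.E) ∈ E}

/-- `U ⊆ Σ_Γ` is open in the subshift. -/
def OpenInShift (U : Set (ℕ → Γ.E)) : Prop :=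
  IsOpen {x : ↥Γ.shift | (x : ℕ → Γ.E) ∈ U}

/-- The subshift `Σ_Γ` has no isolated points. -/
def NoIsolatedPoints : Prop := ∀ x : ↥Γ.shift, ¬IsOpen ({x} : Set ↥Γ.shift)

/-- The subshift `Σ_Γ` has no empty cones. -/
def NoEmptyCones : Prop := ∀ α : Γ.FinPath, (Γ.cone α).Nonempty

/-- A permutation of `E` which is a homeomorphism and is a rational map:
an element of the rational group `R_{Γ,E}`. -/
def IsRatHomeo (E : Set (ℕ → Γ.E)) (g : Equiv.Perm ↥E) : Prop :=
  Continuous ⇑g ∧ Continuous ⇑g.symm ∧ Γ.RationalOn (Γ.permExt E g) E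

/-- `g` maps the cone `C_α` to the cone `C_β` by the canonical similarity
`α·ω ↦ β·ω`. -/
def RealizesCanonSim (E : Set (ℕ → Γ.E)) (g : Equiv.Perm ↥E) (α β : Γ.FinPath) : Prop :=
  ∀ x, ∀ hx : x ∈ E, x ∈ Γ.cone α → ↑(g ⟨x, hx⟩) = Γ.splice α β x

/-- A rational similarity group (RSG): a subgroup of the rational group `R_{Γ,E}` that
realizes the canonical similarity between any two cones `C_α, C_β ⊊ E` with
`t(α) = t(β)`. -/
def IsRSG (E : Set (ℕ → Γ.E)) (G : Subgroup (Equiv.Perm ↥E)) : Prop :=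
  (∀ g ∈ G, Γ.IsRatHomeo E g) ∧
  ∀ α β : Γ.FinPath, Γ.pathEnd α = Γ.pathEnd β → Γ.cone α ⊂ E → Γ.cone β ⊂ E →
    ∃ g ∈ G, Γ.RealizesCanonSim E g α β

/-- `h` locally agrees with the group `G`: every point has an open neighborhood on
which `h` coincides with some element of `G`. -/
def LocallyAgrees (E : Set (ℕ → Γ.E)) (G : Subgroup (Equiv.Perm ↥E))
    (h : Equiv.Perm ↥E) : Prop :=
  ∀ x : ↥E, ∃ U : Set ↥E, IsOpen U ∧ x ∈ U ∧ ∃ g ∈ G, ∀ u ∈ U, h u = g u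

/-- `G` is full as a group of homeomorphisms of `E`: every homeomorphism of `E` that
locally agrees with `G` already belongs to `G`. -/
def IsFullOn (E : Set (ℕ → Γ.E)) (G : Subgroup (Equiv.Perm ↥E)) : Prop :=
  ∀ h : Equiv.Perm ↥E, Continuous ⇑h → Continuous ⇑h.symm →
    Γ.LocallyAgrees E G h → h ∈ G

/-- The nucleus `𝒩_G` of a subgroup `G ≤ R_{Γ,E}`: the union of the nuclei of its
elements. -/
def groupNucleus (E : Set (ℕ → Γ.E)) (G : Subgroup (Equiv.Perm ↥E)) :
    Set (Γ.V × ((ℕ → Γ.E) → ℕ → Γ.E)) :=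
  ⋃ g ∈ G, Γ.nucleusOf (Γ.permExt E g) E

/-- An edge of the induced subgraph on a set `W` of nodes. -/
def InducedEdge (W : Set Γ.V) (e : Γ.E) : Prop := Γ.o e ∈ W ∧ Γ.t e ∈ W

/-- A path of the induced subgraph on `W`. -/
def PathIn (W : Set Γ.V) (α : Γ.FinPath) : Prop :=
  α.start ∈ W ∧ ∀ e ∈ α.edges, Γ.InducedEdge W e

/-- The induced subgraph on `W` is strongly connected and is not a directed cycle,
i.e. `Σ_{Γ₀}` is irreducible (where `Γ₀` is the induced subgraph on `W`). -/
def IrreducibleOn (W : Set Γ.V) : Prop :=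
  (∀ v ∈ W, ∀ w ∈ W, ∃ α : Γ.FinPath,
      α.start = v ∧ Γ.pathEnd α = w ∧ α.edges ≠ [] ∧ Γ.PathIn W α) ∧
  ¬∀ v ∈ W, ∃! e : Γ.E, Γ.InducedEdge W e ∧ Γ.o e = v

/-- `Σ_Γ` has an irreducible core: an induced subgraph `Γ₀` (on a node set `W`) with
`Σ_{Γ₀}` irreducible, such that every node has a directed path to `Γ₀` and every
sufficiently long directed path ends in `Γ₀`. -/
def HasIrreducibleCore : Prop :=
  ∃ W : Set Γ.V, Γ.IrreducibleOn W ∧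
    (∀ v : Γ.V, ∃ α : Γ.FinPath, α.start = v ∧ Γ.pathEnd α ∈ W) ∧
    ∃ N : ℕ, ∀ α : Γ.FinPath, α.edges.length = N → Γ.pathEnd α ∈ W

/-- `G ≤ R_{Γ,E}` is contracting: `Σ_Γ` has an irreducible core and the nucleus `𝒩_G`
is finite. -/
def IsContracting (E : Set (ℕ → Γ.E)) (G : Subgroup (Equiv.Perm ↥E)) : Prop :=
  Γ.HasIrreducibleCore ∧ (Γ.groupNucleus E G).Finite

/-- An element of the Thompson group `V_{Γ,E}`: there are partitions of `E` into cones
`C_{α_1},…,C_{α_k}` and `C_{β_1},…,C_{β_k}` with `t(α_i) = t(β_i)` such that `g` maps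
each `C_{α_i}` to `C_{β_i}` by the canonical similarity. -/
def IsThompson (E : Set (ℕ → Γ.E)) (g : Equiv.Perm ↥E) : Prop :=
  ∃ (k : ℕ) (α β : Fin k → Γ.FinPath),
    (∀ i, Γ.pathEnd (α i) = Γ.pathEnd (β i)) ∧
    E = (⋃ i, Γ.cone (α i)) ∧
    Pairwise (fun i j => Disjoint (Γ.cone (α i)) (Γ.cone (α j))) ∧
    E = (⋃ i, Γ.cone (β i)) ∧
    Pairwise (fun i j => Disjoint (Γ.cone (β i)) (Γ.cone (β j))) ∧
    ∀ i, Γ.RealizesCanonSim E g (α i) (β i)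

/-- A rational (eventually repeating) point `σ·τ^∞` of `Σ_Γ`. -/
def IsRationalPt (x : ℕ → Γ.E) : Prop :=
  ∃ σ τ : Γ.FinPath, τ.edges ≠ [] ∧
    (∀ (i : ℕ) (h : i < σ.edges.length), x i = σ.edges.get ⟨i, h⟩) ∧
    ∀ i : ℕ, σ.edges.length ≤ i →
      ∀ h : (i - σ.edges.length) % τ.edges.length < τ.edges.length,
        x i = τ.edges.get ⟨(i - σ.edges.length) % τ.edges.length, h⟩

/-- `β = f̄(α)`: the cone `C_β` is the smallest cone containing `f(C_α)`, with `β` the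
greatest common prefix of the points of `f(C_α)`. -/
def IsBar (f : (ℕ → Γ.E) → ℕ → Γ.E) (α β : Γ.FinPath) : Prop :=
  f '' Γ.cone α ⊆ Γ.cone β ∧
  ∀ γ : Γ.FinPath, f '' Γ.cone α ⊆ Γ.cone γ →
    Γ.cone β ⊆ Γ.cone γ ∧ γ.edges.length ≤ β.edges.length

end FinDigraph

/-- The (level-indexed) infinite atoms of a group with generating set `S`. -/
def AtomIdx {K : Type} [Group K] (S : Set K) : Type :=
  Σ n : ℕ, {A : Set K // A ∈ InfAtoms S n}

/-- Two indexed atoms have the same type. -/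
def SameTypeIdx {K : Type} [Group K] (S : Set K) (p q : AtomIdx S) : Prop :=
  SameType S p.1 p.2.1 q.1 q.2.1

/-- The group has finitely many types of infinite atoms. -/
def FinitelyManyTypes {K : Type} [Group K] (S : Set K) : Prop :=
  ∃ R : Set (AtomIdx S), R.Finite ∧ ∀ p : AtomIdx S, ∃ q ∈ R, SameTypeIdx S p q

/-- `Δ` (together with the type assignment `τ`) is the type graph: nodes are the types
of infinite atoms, with as many edges from `v` to `w` as each atom of type `v` has
children of type `w`. -/
def IsTypeGraph {K : Type} [Group K] (S : Set K) (Δ : FinDigraph)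
    (τ : AtomIdx S → Δ.V) : Prop :=
  Function.Surjective τ ∧
  (∀ p q : AtomIdx S, τ p = τ q ↔ SameTypeIdx S p q) ∧
  ∀ (p : AtomIdx S) (w : Δ.V),
    {q : AtomIdx S | q.1 = p.1 + 1 ∧ q.2.1 ⊆ p.2.1 ∧ τ q = w}.ncard =
      {e : Δ.E | Δ.o e = τ p ∧ Δ.t e = w}.ncard

/-- The free product `G ∗ ℤ`. -/
abbrev FPZ (G : Type) [Group G] : Type := Monoid.Coprod G (Multiplicative ℤ)

/-- The generator `t` of the `ℤ` free factor. -/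
def tGen (G : Type) [Group G] : FPZ G := Monoid.Coprod.inr (Multiplicative.ofAdd 1)

/-- The generating set of `G ∗ ℤ`: a generating set of `G` together with `t`. -/
def fpGen (G : Type) [Group G] (S : Set G) : Set (FPZ G) :=
  (⇑(Monoid.Coprod.inl : G →* FPZ G) '' S) ∪ {tGen G}

section WordMetric

variable {H : Type} [Group H] {S : Set H}

theorem exists_list_length_eq_wordLength (hS : Subgroup.closure S = ⊤) (g : H) :
    ∃ l : List H, l.length = wordLength S g ∧ (∀ x ∈ l, x ∈ S ∨ x⁻¹ ∈ S) ∧ l.prod = g := by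
  have h : {n | ∃ l : List H, l.length = n ∧ (∀ x ∈ l, x ∈ S ∨ x⁻¹ ∈ S) ∧
      l.prod = g}.Nonempty := by
    have hg : g ∈ (Subgroup.closure S).toSubmonoid := by
      rw [hS]
      trivial
    rw [Subgroup.closure_toSubmonoid] at hg
    obtain ⟨l, hl, hg⟩ := Submonoid.exists_list_of_mem_closure hg
    exact ⟨_, l, rfl, hl, hg⟩
  exact Nat.sInf_mem h

theorem wordLength_prod_le_length {l : List H} (hl : ∀ x ∈ l, x ∈ S ∨ x⁻¹ ∈ S) :
    wordLength S l.prod ≤ l.length :=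
  Nat.sInf_le ⟨l, rfl, hl, rfl⟩

theorem wordDist_self (x : H) : wordDist S x x = 0 := by
  have h := wordLength_prod_le_length (S := S) (l := []) (by simp)
  simpa [wordDist] using h

theorem wordDist_mul_left (g x y : H) :
    wordDist S (g * x) (g * y) = wordDist S x y := by
  simp [wordDist, mul_assoc]

theorem mem_ball_iff {n : ℕ} {x : H} : x ∈ ball S n ↔ wordDist S 1 x ≤ n := by
  simp [ball, wordDist]

theorem wordDist_mul_right_le_one {s : H} (hs : s ∈ S ∨ s⁻¹ ∈ S) (x : H) :
    wordDist S x (x * s) ≤ 1 := by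
  have h := wordLength_prod_le_length (S := S) (l := [s]) (by simpa using hs)
  simpa [wordDist] using h

theorem wordLength_inv_le (hS : Subgroup.closure S = ⊤) (g : H) :
    wordLength S g⁻¹ ≤ wordLength S g := by
  obtain ⟨l, hn, hl, rfl⟩ := exists_list_length_eq_wordLength hS g
  rw [← hn, List.prod_inv_reverse]
  refine (wordLength_prod_le_length ?_).trans (by simp)
  intro x hx
  simp only [List.mem_reverse, List.mem_map] at hx
  obtain ⟨y, hy, rfl⟩ := hx
  simpa [or_comm] using hl y hy

theorem wordDist_comm (hS : Subgroup.closure S = ⊤) (x y : H) :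
    wordDist S x y = wordDist S y x := by
  have h := wordLength_inv_le hS (x⁻¹ * y)
  have h' := wordLength_inv_le hS (y⁻¹ * x)
  simp only [mul_inv_rev, inv_inv] at h h'
  exact le_antisymm h' h

theorem wordDist_triangle (hS : Subgroup.closure S = ⊤) (x y z : H) :
    wordDist S x z ≤ wordDist S x y + wordDist S y z := by
  obtain ⟨l, hn, hl, hp⟩ := exists_list_length_eq_wordLength hS (x⁻¹ * y)
  obtain ⟨l', hn', hl', hp'⟩ := exists_list_length_eq_wordLength hS (y⁻¹ * z)
  have h := wordLength_prod_le_length (S := S) (l := l ++ l') (by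
    intro w hw
    rcases List.mem_append.1 hw with hw | hw
    exacts [hl w hw, hl' w hw])
  rw [List.prod_append, hp, hp', List.length_append, hn, hn'] at h
  simpa [wordDist, mul_assoc] using h

theorem eq_of_wordDist_eq_zero (hS : Subgroup.closure S = ⊤) {x y : H}
    (h : wordDist S x y = 0) : x = y := by
  obtain ⟨l, hn, -, hp⟩ := exists_list_length_eq_wordLength hS (x⁻¹ * y)
  rw [show wordLength S (x⁻¹ * y) = 0 from h, List.length_eq_zero_iff] at hn
  subst hn
  exact inv_mul_eq_one.1 hp.symm

theorem exists_adjacent_closer (hS : Subgroup.closure S = ⊤) {x y : H} (h : x ≠ y) :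
    ∃ s, (s ∈ S ∨ s⁻¹ ∈ S) ∧ wordDist S (x * s) y + 1 = wordDist S x y := by
  obtain ⟨l, hn, hl, hp⟩ := exists_list_length_eq_wordLength hS (x⁻¹ * y)
  cases l with
  | nil => exact absurd (inv_mul_eq_one.1 hp.symm) h
  | cons s l =>
    have hs : s ∈ S ∨ s⁻¹ ∈ S := hl s (by simp)
    refine ⟨s, hs, le_antisymm ?_ ?_⟩
    · have h1 := wordLength_prod_le_length (S := S) (l := l)
        (fun w hw => hl w (List.mem_cons_of_mem _ hw))
      have h2 : l.prod = (x * s)⁻¹ * y := by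
        rw [mul_inv_rev, mul_assoc, ← hp, List.prod_cons, inv_mul_cancel_left]
      rw [h2] at h1
      rw [List.length_cons] at hn
      have h3 : wordDist S x y = l.length + 1 := hn.symm
      rw [h3]
      exact Nat.succ_le_succ h1
    · have h1 := wordDist_triangle hS x (x * s) y
      have h2 := wordDist_mul_right_le_one hs x
      omega

theorem finite_ball (hS : Subgroup.closure S = ⊤) (hfin : S.Finite) (n : ℕ) :
    (ball S n).Finite := by
  have hF : (S ∪ S⁻¹).Finite := hfin.union hfin.inv
  have : Finite ↥(S ∪ S⁻¹) := hF
  refine ((List.finite_length_le ↥(S ∪ S⁻¹) n).image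
    (fun l => (l.map Subtype.val).prod)).subset ?_
  intro g hg
  obtain ⟨l, hn, hl, rfl⟩ := exists_list_length_eq_wordLength hS g
  have hl' : ∀ x ∈ l, x ∈ S ∪ S⁻¹ := hl
  lift l to List ↥(S ∪ S⁻¹) using hl'
  refine ⟨l, ?_, rfl⟩
  have hg' : wordLength S (l.map Subtype.val).prod ≤ n := hg
  rw [← hn] at hg'
  simpa using hg'

theorem exists_mem_le_wordDist (hS : Subgroup.closure S = ⊤) (hfin : S.Finite)
    {A : Set H} (hA : A.Infinite) (n : ℕ) : ∃ x ∈ A, n ≤ wordDist S 1 x := by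
  obtain ⟨x, hx, hxn⟩ := hA.exists_notMem_finite (finite_ball hS hfin n)
  rw [mem_ball_iff] at hxn
  exact ⟨x, hx, by omega⟩

end WordMetric

section Bridge

variable {H : Type} [Group H] {S : Set H}

/-- The edge from `1` to `u` separates the Cayley graph, and `T` is the side of `u`. -/
structure IsBridge (S : Set H) (u : H) (T : Set H) : Prop where
  one_notMem : 1 ∉ T
  self_mem : u ∈ T
  mul_self_mem : u * u ∈ T
  dist_eq : ∀ y ∈ T, ∀ b ∉ T,
    wordDist S y b = wordDist S y u + 1 + wordDist S 1 b

theorem isBridge_of_crossing (hS : Subgroup.closure S = ⊤) {u : H} {T : Set H}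
    (hu : u ∈ S ∨ u⁻¹ ∈ S) (h1 : 1 ∉ T) (huT : u ∈ T) (huu : u * u ∈ T)
    (hcross : ∀ x s, (s ∈ S ∨ s⁻¹ ∈ S) → x ∉ T → x * s ∈ T → x = 1 ∧ s = u) :
    IsBridge S u T := by
  refine ⟨h1, huT, huu, fun y hy b hb => le_antisymm ?_ ?_⟩
  · have e1 := wordDist_triangle hS y u b
    have e2 := wordDist_triangle hS u 1 b
    have e3 := wordDist_mul_right_le_one hu 1
    rw [one_mul, wordDist_comm hS] at e3
    omega
  · rw [wordDist_comm hS y b, wordDist_comm hS y u]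
    generalize hn : wordDist S b y = n
    induction n generalizing b with
    | zero => exact absurd (eq_of_wordDist_eq_zero hS hn ▸ hy) hb
    | succ n ih =>
      have hne : b ≠ y := fun h => hb (h ▸ hy)
      obtain ⟨s, hs, hd⟩ := exists_adjacent_closer hS hne
      by_cases hbs : b * s ∈ T
      · obtain ⟨rfl, rfl⟩ := hcross b s hs hb hbs
        rw [wordDist_self, one_mul] at *
        omega
      · have e1 := ih (b * s) hbs (by omega)
        have e2 := wordDist_triangle hS 1 (b * s) b
        have e3 := wordDist_mul_right_le_one hs b
        rw [wordDist_comm hS] at e3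
        omega

namespace IsBridge

variable {u : H} {T : Set H}

theorem dist_translate (hB : IsBridge S u T) {x y b : H} (hy : x⁻¹ * y ∈ T)
    (hb : x⁻¹ * b ∉ T) :
    wordDist S y b = wordDist S y (x * u) + 1 + wordDist S x b := by
  have h := hB.dist_eq _ hy _ hb
  rw [← wordDist_mul_left x (x⁻¹ * y) u, ← wordDist_mul_left x 1, wordDist_mul_left,
    mul_inv_cancel_left, mul_inv_cancel_left, mul_one] at h
  exact h

theorem dist_translate_base (hB : IsBridge S u T) {x y : H} (hy : x⁻¹ * y ∈ T) :
    wordDist S y x = wordDist S y (x * u) + 1 := by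
  have h := hB.dist_translate hy (b := x) (by simpa using hB.one_notMem)
  rwa [wordDist_self, add_zero] at h

theorem dist_translate_tip (hB : IsBridge S u T) {x b : H} (hb : x⁻¹ * b ∉ T) :
    wordDist S (x * u) b = 1 + wordDist S x b := by
  have h := hB.dist_translate (y := x * u) (by simpa using hB.self_mem) hb
  rwa [wordDist_self, zero_add] at h

theorem inv (hS : Subgroup.closure S = ⊤) (hB : IsBridge S u T) :
    IsBridge S u⁻¹ {x | u * x ∉ T} := by
  refine ⟨by simpa using hB.self_mem, by simpa using hB.one_notMem, ?_, ?_⟩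
  · intro h
    rw [mul_inv_cancel_left] at h
    have e := hB.dist_translate_base (x := 1) (y := u⁻¹) (by simpa using h)
    rw [one_mul] at e
    have e1 : wordDist S u⁻¹ 1 = 1 := by
      have := hB.dist_translate_base (x := 1) (y := u) (by simpa using hB.self_mem)
      rw [one_mul, wordDist_self, zero_add] at this
      rw [← wordDist_mul_left u, mul_inv_cancel, mul_one, wordDist_comm hS, this]
    have e2 := eq_of_wordDist_eq_zero hS (show wordDist S u⁻¹ u = 0 by omega)
    refine hB.one_notMem ?_
    have e3 := hB.mul_self_mem
    nth_rewrite 1 [← e2] at e3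
    rwa [inv_mul_cancel] at e3
  · intro y hy b hb
    have hb' : u * b ∈ T := by simpa using hb
    have h := hB.dist_eq _ hb' _ hy
    rw [wordDist_mul_left, wordDist_comm hS b y] at h
    rw [h, ← wordDist_mul_left u y u⁻¹, ← wordDist_mul_left u 1 b, mul_inv_cancel, mul_one,
      wordDist_comm hS (u * b), wordDist_comm hS 1]
    ring

theorem mul_mem (hS : Subgroup.closure S = ⊤) (hB : IsBridge S u T) {z : H} (hz : z ∈ T) :
    u * z ∈ T := by
  by_contra h
  have e1 := hB.dist_translate_base (x := 1) (y := z) (by simpa using hz)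
  have e2 := hB.dist_translate_tip (x := 1) (b := u * z) (by simpa using h)
  have e3 := hB.dist_eq _ hB.mul_self_mem _ h
  have e4 : wordDist S u (u * z) = wordDist S 1 z := by
    rw [← wordDist_mul_left u 1 z, mul_one]
  have e5 : wordDist S (u * u) (u * z) = wordDist S u z := wordDist_mul_left _ _ _
  rw [one_mul] at e1 e2
  rw [wordDist_comm hS z, wordDist_comm hS z] at e1
  omega

theorem inv_mul_notMem (hS : Subgroup.closure S = ⊤) (hB : IsBridge S u T) {z : H}
    (hz : z ∉ T) : u⁻¹ * z ∉ T := fun h => hz (by simpa using hB.mul_mem hS h)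

/-- Two distinct halfspaces, neither of whose bases lies in the other, are disjoint. -/
theorem disjoint_translate (hS : Subgroup.closure S = ⊤) (hB : IsBridge S u T) {v : H}
    {T' : Set H} (hB' : IsBridge S v T') {a : H} (ha : a ≠ 1) (ha1 : a⁻¹ ∉ T)
    (ha2 : a ∉ T') {z : H} (hz : z ∈ T) : a * z ∉ T' := by
  intro h
  have e1 := hB.dist_translate (x := a) (y := a * z) (b := 1) (by simpa using hz)
    (by simpa using ha1)
  have e2 := hB.dist_translate_base (x := a) (y := a * z) (by simpa using hz)
  have e3 := hB'.dist_translate (x := 1) (y := a * z) (b := a) (by simpa using h)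
    (by simpa using ha2)
  have e4 := hB'.dist_translate_base (x := 1) (y := a * z) (by simpa using h)
  exact ha (eq_of_wordDist_eq_zero hS (show wordDist S a 1 = 0 by omega))

theorem notMem_of_dist_le (hS : Subgroup.closure S = ⊤) (hB : IsBridge S u T) {x b : H}
    (hx : x⁻¹ ∉ T) (hb : wordDist S 1 b ≤ wordDist S 1 x) : x⁻¹ * b ∉ T := by
  intro h
  have e := hB.dist_translate (b := 1) h (by simpa using hx)
  rw [wordDist_comm hS b 1, wordDist_comm hS x 1] at e
  omega

theorem dist_one_mul_mem (hS : Subgroup.closure S = ⊤) (hB : IsBridge S u T) {x y : H}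
    (hx : x⁻¹ ∉ T) (hy : u * y ∈ T) :
    wordDist S 1 (x * u * y) = wordDist S 1 x + 1 + wordDist S 1 y := by
  have e := hB.dist_translate (x := x) (y := x * u * y) (b := 1)
    (by simpa [mul_assoc] using hy) (by simpa using hx)
  have e' := wordDist_mul_left (S := S) (x * u) y 1
  rw [mul_one] at e'
  rw [wordDist_comm hS, e, e', wordDist_comm hS y, wordDist_comm hS x]
  ring

theorem dist_one_mul (hS : Subgroup.closure S = ⊤) (hB : IsBridge S u T) {x : H}
    (hx : x⁻¹ ∉ T) : wordDist S 1 (x * u) = wordDist S 1 x + 1 := by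
  have h := hB.dist_one_mul_mem hS hx (y := 1) (by simpa using hB.self_mem)
  rwa [mul_one, wordDist_self, add_zero] at h

theorem inv_mul_pow_notMem (hS : Subgroup.closure S = ⊤) (hB : IsBridge S u T) {x : H}
    (hx : x⁻¹ ∉ T) (k : ℕ) : (x * u ^ k)⁻¹ ∉ T := by
  induction k with
  | zero => simpa using hx
  | succ k ih =>
    rw [pow_succ, ← mul_assoc, mul_inv_rev]
    exact hB.inv_mul_notMem hS ih

theorem dist_one_mul_pow (hS : Subgroup.closure S = ⊤) (hB : IsBridge S u T) {x : H}
    (hx : x⁻¹ ∉ T) (k : ℕ) : wordDist S 1 (x * u ^ k) = wordDist S 1 x + k := by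
  induction k with
  | zero => simp
  | succ k ih =>
    rw [pow_succ, ← mul_assoc, hB.dist_one_mul hS (hB.inv_mul_pow_notMem hS hx k), ih]
    ring

theorem pow_mem (hS : Subgroup.closure S = ⊤) (hB : IsBridge S u T) (k : ℕ) :
    u ^ (k + 1) ∈ T := by
  induction k with
  | zero => simpa using hB.self_mem
  | succ k ih =>
    rw [pow_succ']
    exact hB.mul_mem hS ih

theorem infinite (hS : Subgroup.closure S = ⊤) (hB : IsBridge S u T) : T.Infinite := by
  refine Set.infinite_of_injective_forall_mem (f := fun k : ℕ => u ^ (k + 1)) ?_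
    (hB.pow_mem hS)
  intro i j hij
  have h := fun k => hB.dist_one_mul_pow hS (x := 1) (by simpa using hB.one_notMem) k
  simp only [one_mul] at h
  have hi := h (i + 1)
  have hj := h (j + 1)
  simp only at hij
  rw [hij] at hi
  omega

end IsBridge

end Bridge

section Atoms

variable {H : Type} [Group H] {S : Set H}

theorem sameAtom_iff {n : ℕ} {x y : H} :
    SameAtom S n x y ↔ ∀ b, wordDist S 1 b ≤ n →
      (wordDist S x b : ℤ) - wordDist S y b = wordDist S x 1 - wordDist S y 1 := by
  constructor
  · intro h b hb
    exact h b (mem_ball_iff.2 hb) 1 (mem_ball_iff.2 (by simp [wordDist_self]))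
  · intro h a ha b hb
    rw [h a (mem_ball_iff.1 ha), h b (mem_ball_iff.1 hb)]

theorem SameAtom.refl (n : ℕ) (x : H) : SameAtom S n x x := fun a _ b _ => by simp

theorem SameAtom.symm {n : ℕ} {x y : H} (h : SameAtom S n x y) : SameAtom S n y x := by
  intro a ha b hb
  have := h a ha b hb
  omega

theorem SameAtom.trans {n : ℕ} {x y z : H} (h : SameAtom S n x y) (h' : SameAtom S n y z) :
    SameAtom S n x z := by
  intro a ha b hb
  have := h a ha b hb
  have := h' a ha b hb
  omega

theorem SameAtom.mono {m n : ℕ} (hmn : m ≤ n) {x y : H} (h : SameAtom S n x y) :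
    SameAtom S m x y :=
  fun a ha b hb => h a (le_trans ha hmn) b (le_trans hb hmn)

/-- A shift of `d_x` agreeing with `d_y` on a ball puts `x` and `y` in the same atom. -/
theorem sameAtom_of_forall_eq_add {n : ℕ} {x y : H} (c : ℕ)
    (h : ∀ b, wordDist S 1 b ≤ n → wordDist S y b = wordDist S x b + c) :
    SameAtom S n x y := by
  intro a ha b hb
  rw [h a (mem_ball_iff.1 ha), h b (mem_ball_iff.1 hb)]
  push_cast
  ring

theorem atomOf_eq {n : ℕ} {x y : H} (h : SameAtom S n x y) : atomOf S n x = atomOf S n y :=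
  Set.ext fun _ => ⟨h.symm.trans, h.trans⟩

theorem mem_atomOf_self (n : ℕ) (x : H) : x ∈ atomOf S n x := SameAtom.refl n x

theorem eq_atomOf_of_mem {n : ℕ} {A : Set H} (hA : A ∈ InfAtoms S n) {x : H} (hx : x ∈ A) :
    A = atomOf S n x := by
  obtain ⟨⟨y, rfl⟩, -⟩ := hA
  exact atomOf_eq hx

theorem atomOf_subset {m n : ℕ} (hmn : m ≤ n) {A : Set H} (hA : A ∈ InfAtoms S m) {x : H}
    (hx : x ∈ A) : atomOf S n x ⊆ A := by
  rw [eq_atomOf_of_mem hA hx]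
  exact fun _ hy => SameAtom.mono hmn hy

theorem atoms_eq_of_not_disjoint {n : ℕ} {A B : Set H} (hA : A ∈ InfAtoms S n)
    (hB : B ∈ InfAtoms S n) {x : H} (hxA : x ∈ A) (hxB : x ∈ B) : A = B := by
  rw [eq_atomOf_of_mem hA hxA, eq_atomOf_of_mem hB hxB]

theorem finite_atoms (hS : Subgroup.closure S = ⊤) (hfin : S.Finite) (n : ℕ) :
    (Set.range (atomOf S n)).Finite := by
  have hball : Finite ↥(ball S n) := finite_ball hS hfin n
  let f : H → ↥(ball S n) → ℤ := fun x b => (wordDist S x b : ℤ) - wordDist S x 1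
  have hf : (Set.range f).Finite := by
    refine (Set.Finite.pi' (t := fun _ : ↥(ball S n) => Set.Icc (-n : ℤ) n)
      (fun _ => Set.finite_Icc _ _)).subset ?_
    rintro _ ⟨x, rfl⟩ ⟨b, hb⟩
    rw [mem_ball_iff] at hb
    have e1 := wordDist_triangle hS x 1 b
    have e2 := wordDist_triangle hS x b 1
    rw [wordDist_comm hS b 1] at e2
    simp only [f, Set.mem_Icc]
    omega
  refine (hf.image fun φ => {y | f y = φ}).subset ?_
  rintro _ ⟨x, rfl⟩
  refine ⟨f x, ⟨x, rfl⟩, Set.ext fun y => ⟨fun h => ?_, fun h => ?_⟩⟩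
  · refine sameAtom_iff.2 fun b hb => ?_
    have := congrFun h ⟨b, mem_ball_iff.2 hb⟩
    simp only [f] at this
    omega
  · funext ⟨b, hb⟩
    have := sameAtom_iff.1 h b (mem_ball_iff.1 hb)
    simp only [f]
    omega

theorem exists_infAtom_inter (hS : Subgroup.closure S = ⊤) (hfin : S.Finite) {A : Set H}
    (hA : A.Infinite) (n : ℕ) : ∃ B ∈ InfAtoms S n, (A ∩ B).Nonempty := by
  by_contra! hcon
  refine hA ?_
  have h : A ⊆ ⋃ B ∈ {B ∈ Set.range (atomOf S n) | B.Finite}, B := by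
    intro x hx
    refine Set.mem_biUnion (x := atomOf S n x) ⟨⟨x, rfl⟩, ?_⟩ (mem_atomOf_self n x)
    by_contra hinf
    have := hcon (atomOf S n x) ⟨⟨x, rfl⟩, hinf⟩
    exact Set.notMem_empty x (this ▸ ⟨hx, mem_atomOf_self n x⟩)
  exact (Set.Finite.biUnion ((finite_atoms hS hfin n).subset (Set.sep_subset _ _))
    fun B hB => hB.2).subset h

theorem exists_child (hS : Subgroup.closure S = ⊤) (hfin : S.Finite) {n : ℕ} {A : Set H}
    (hA : A ∈ InfAtoms S n) : ∃ B ∈ InfAtoms S (n + 1), B ⊆ A := by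
  obtain ⟨B, hB, x, hxA, hxB⟩ := exists_infAtom_inter hS hfin hA.2 (n + 1)
  refine ⟨B, hB, ?_⟩
  rw [eq_atomOf_of_mem hB hxB]
  exact atomOf_subset (Nat.le_succ n) hA hxA

namespace IsMorphism

variable {g : H} {m n : ℕ} {A B : Set H}

theorem mem (hg : IsMorphism S g m A n B) {x : H} (hx : x ∈ A) : g * x ∈ B :=
  hg.1 ▸ ⟨x, hx, rfl⟩

theorem refl (A : AtomIdx S) : IsMorphism S 1 A.1 A.2.1 A.1 A.2.1 := by
  refine ⟨by simp, by simp, fun k _ A' hA' hsub => ?_⟩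
  simpa using ⟨hA', hsub⟩

theorem inv (hS : Subgroup.closure S = ⊤) (hfin : S.Finite)
    (hA : A ∈ InfAtoms S m) (hg : IsMorphism S g m A n B) :
    IsMorphism S g⁻¹ n B m A := by
  have himg : ∀ X : Set H, (g⁻¹ * ·) '' ((g * ·) '' X) = X := fun X => by
    rw [Set.image_image]
    simp
  refine ⟨by rw [← hg.1, himg], fun k => by rw [← hg.2.1, himg], fun k hk B' hB' hsub => ?_⟩
  have hinf : ((g⁻¹ * ·) '' B').Infinite :=
    hB'.2.image (mul_right_injective g⁻¹).injOn
  obtain ⟨A', hA', x, hx, hxA'⟩ := exists_infAtom_inter hS hfin hinf (m + k)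
  obtain ⟨y, hy, rfl⟩ := hx
  have hyA : g⁻¹ * y ∈ A := by
    have := hsub hy
    rw [← hg.1] at this
    obtain ⟨z, hz, rfl⟩ := this
    simpa using hz
  have hsub' : A' ⊆ A := by
    rw [eq_atomOf_of_mem hA' hxA']
    exact atomOf_subset (Nat.le_add_right m k) hA hyA
  have h := hg.2.2 k hk A' hA' hsub'
  have heq : (g * ·) '' A' = B' :=
    atoms_eq_of_not_disjoint h.1 hB' (x := y) ⟨_, hxA', by simp⟩ hy
  rw [← heq, himg]
  exact ⟨hA', hsub'⟩

theorem trans {g' : H} {l : ℕ} {C : Set H} (hg : IsMorphism S g m A n B)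
    (hg' : IsMorphism S g' n B l C) : IsMorphism S (g' * g) m A l C := by
  have himg : ∀ X : Set H, (g' * g * ·) '' X = (g' * ·) '' ((g * ·) '' X) := fun X => by
    rw [Set.image_image]
    simp [mul_assoc]
  refine ⟨by rw [himg, hg.1, hg'.1], fun k => by rw [himg, hg.2.1, hg'.2.1],
    fun k hk A' hA' hsub => ?_⟩
  rw [himg]
  have h := hg.2.2 k hk A' hA' hsub
  exact hg'.2.2 k hk _ h.1 h.2

theorem restrict (hg : IsMorphism S g m A n B) {A' : Set H} (hsub : A' ⊆ A) :
    IsMorphism S g (m + 1) A' (n + 1) ((g * ·) '' A') := by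
  refine ⟨rfl, fun k => ?_, fun k hk A'' hA'' hsub' => ⟨?_, Set.image_mono hsub'⟩⟩
  · ext z
    constructor
    · rintro ⟨x, ⟨hx, hxk⟩, rfl⟩
      refine ⟨⟨x, hx, rfl⟩, ?_⟩
      have : g * x ∈ B ∩ ball S (n + (1 + k)) := by
        rw [← hg.2.1]
        exact ⟨x, ⟨hsub hx, by rwa [← add_assoc]⟩, rfl⟩
      rw [add_assoc]
      exact this.2
    · rintro ⟨⟨x, hx, rfl⟩, hxk⟩
      have : g * x ∈ B ∩ ball S (n + (1 + k)) :=
        ⟨hg.mem (hsub hx), by rw [← add_assoc]; exact hxk⟩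
      rw [← hg.2.1] at this
      obtain ⟨y, hy, hyx⟩ := this
      obtain rfl : y = x := mul_left_cancel hyx
      exact ⟨y, ⟨hx, by rw [add_assoc]; exact hy.2⟩, rfl⟩
  · rw [add_assoc] at hA'' ⊢
    exact (hg.2.2 (1 + k) (by omega) A'' hA'' (hsub'.trans hsub)).1

end IsMorphism

namespace IsBridge

variable {u : H} {T : Set H}

theorem sameAtom_mul (hS : Subgroup.closure S = ⊤) (hB : IsBridge S u T) {x z : H}
    (hx : x⁻¹ ∉ T) (hz : z ∈ T) : SameAtom S (wordDist S 1 x) x (x * z) := by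
  refine sameAtom_of_forall_eq_add (wordDist S (x * z) (x * u) + 1) fun b hb => ?_
  rw [hB.dist_translate (x := x) (by simpa using hz) (hB.notMem_of_dist_le hS hx hb)]
  ring

/-- The halfspace `x * T` is contained in the atoms containing `x`. -/
theorem mul_mem_atom (hS : Subgroup.closure S = ⊤) (hB : IsBridge S u T) {n : ℕ} {A : Set H}
    (hA : A ∈ InfAtoms S n) {x z : H} (hxA : x ∈ A) (hn : n ≤ wordDist S 1 x)
    (hx : x⁻¹ ∉ T) (hz : z ∈ T) : x * z ∈ A :=
  atomOf_subset hn hA hxA (hB.sameAtom_mul hS hx hz)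

theorem mem_of_sameAtom (hS : Subgroup.closure S = ⊤) (hB : IsBridge S u T) {x y z : H}
    {n : ℕ} (hn : wordDist S 1 x + 1 ≤ n) (hx : x⁻¹ ∉ T) (hy : x⁻¹ * y ∈ T)
    (h : SameAtom S n y z) : x⁻¹ * z ∈ T := by
  by_contra hz
  have e1 := hB.dist_translate_base hy
  have e2 := hB.dist_translate_tip hz
  have e3 := h x (mem_ball_iff.2 (by omega)) (x * u)
    (mem_ball_iff.2 (by rw [hB.dist_one_mul hS hx]; omega))
  rw [wordDist_comm hS, wordDist_comm hS x] at e2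
  omega

theorem sameAtom_translate_iff (hS : Subgroup.closure S = ⊤) (hB : IsBridge S u T)
    {x y z : H} (hx : x⁻¹ ∉ T) (hy : u * y ∈ T) (hz : u * z ∈ T) (k : ℕ) :
    SameAtom S (wordDist S 1 x + 1 + k) (x * u * y) (x * u * z) ↔ SameAtom S k y z := by
  have htip : ∀ y, wordDist S (x * u * y) (x * u) = wordDist S y 1 := fun y => by
    simpa using wordDist_mul_left (S := S) (x * u) y 1
  have hbase := hB.dist_one_mul hS hx
  constructor
  · intro h
    refine sameAtom_iff.2 fun b hb => ?_
    by_cases hbT : u * b ∈ T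
    · have e := h (x * u * b) (mem_ball_iff.2 (by rw [hB.dist_one_mul_mem hS hx hbT]; omega))
        (x * u) (mem_ball_iff.2 (by omega))
      rwa [wordDist_mul_left, wordDist_mul_left, htip, htip] at e
    · have h' := fun y (hy : u * y ∈ T) => hB.dist_eq _ hy _ hbT
      have ey := h' y hy
      have ez := h' z hz
      rw [wordDist_mul_left, ← mul_one u, mul_assoc, one_mul, wordDist_mul_left] at ey ez
      omega
  · intro h
    have key : ∀ b, wordDist S 1 b ≤ wordDist S 1 x + 1 + k →
        (wordDist S (x * u * y) b : ℤ) - wordDist S (x * u * z) b =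
          wordDist S y 1 - wordDist S z 1 := by
      intro b hb
      by_cases hbT : x⁻¹ * b ∈ T
      · obtain ⟨c, rfl⟩ : ∃ c, b = x * u * c := ⟨(x * u)⁻¹ * b, by simp [mul_assoc]⟩
        have hc : u * c ∈ T := by simpa [mul_assoc] using hbT
        rw [hB.dist_one_mul_mem hS hx hc] at hb
        rw [wordDist_mul_left, wordDist_mul_left]
        exact sameAtom_iff.1 h c (by omega)
      · rw [hB.dist_translate (y := x * u * y) (by simpa [mul_assoc] using hy) hbT,
          hB.dist_translate (y := x * u * z) (by simpa [mul_assoc] using hz) hbT, htip, htip]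
        push_cast
        ring
    intro a ha b hb
    rw [key a (mem_ball_iff.1 ha), key b (mem_ball_iff.1 hb)]

theorem image_mem_infAtoms (hS : Subgroup.closure S = ⊤) (hB : IsBridge S u T) {x : H}
    (hx : x⁻¹ ∉ T) {k : ℕ} {A : Set H} (hA : A ∈ InfAtoms S k) (hAT : ∀ y ∈ A, u * y ∈ T) :
    (x * u * ·) '' A ∈ InfAtoms S (wordDist S 1 x + 1 + k) := by
  refine ⟨?_, hA.2.image (mul_right_injective _).injOn⟩
  obtain ⟨⟨a, rfl⟩, -⟩ := hA
  have ha := hAT a (mem_atomOf_self k a)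
  refine ⟨x * u * a, Set.ext fun z => ⟨?_, fun hz => ?_⟩⟩
  · rintro ⟨y, hy, rfl⟩
    exact (hB.sameAtom_translate_iff hS hx ha (hAT y hy) k).2 hy
  · have hzT : x⁻¹ * z ∈ T :=
      hB.mem_of_sameAtom hS (Nat.le_add_right _ k) hx (by simpa [mul_assoc] using ha) hz
    obtain ⟨c, rfl⟩ : ∃ c, z = x * u * c := ⟨(x * u)⁻¹ * z, by simp [mul_assoc]⟩
    exact ⟨c, (hB.sameAtom_translate_iff hS hx ha (by simpa [mul_assoc] using hzT) k).1 hz,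
      rfl⟩

theorem isMorphism_image (hS : Subgroup.closure S = ⊤) (hB : IsBridge S u T) {x : H}
    (hx : x⁻¹ ∉ T) {k : ℕ} {A : Set H} (hAT : ∀ y ∈ A, u * y ∈ T) :
    IsMorphism S (x * u) k A (wordDist S 1 x + 1 + k) ((x * u * ·) '' A) := by
  refine ⟨rfl, fun j => ?_, fun j _ A' hA' hsub => ⟨?_, Set.image_mono hsub⟩⟩
  · have key : ∀ y ∈ A, x * u * y ∈ ball S (wordDist S 1 x + 1 + k + j) ↔
        y ∈ ball S (k + j) := by
      intro y hy
      rw [mem_ball_iff, mem_ball_iff, hB.dist_one_mul_mem hS hx (hAT y hy)]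
      omega
    ext z
    constructor
    · rintro ⟨y, ⟨hy, hyj⟩, rfl⟩
      exact ⟨⟨y, hy, rfl⟩, (key y hy).2 hyj⟩
    · rintro ⟨⟨y, hy, rfl⟩, hyj⟩
      exact ⟨y, ⟨hy, (key y hy).1 hyj⟩, rfl⟩
  · rw [add_assoc]
    exact hB.image_mem_infAtoms hS hx hA' fun y hy => hAT y (hsub hy)

theorem dist_mul_of_inv_mem (hS : Subgroup.closure S = ⊤)
    (hB : IsBridge S u T) {x : H} (hx : x⁻¹ ∈ T) {c : H} (hc : c ∉ T) {b : H}
    (hb : wordDist S 1 b ≤ wordDist S 1 x) :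
    wordDist S (x * c) b = wordDist S x b + wordDist S 1 c := by
  have hxc : wordDist S x (x * c) = wordDist S 1 c := by
    simpa using wordDist_mul_left (S := S) x 1 c
  by_cases hbT : x⁻¹ * b ∈ T
  · have e1 := hB.dist_translate (b := x * c) hbT (by simpa using hc)
    have e2 := hB.dist_translate_base hbT
    rw [wordDist_comm hS (x * c), wordDist_comm hS x b]
    omega
  · have e1 := hB.dist_translate (y := 1) (by simpa using hx) hbT
    have e2 := hB.dist_translate_base (x := x) (y := 1) (by simpa using hx)
    obtain rfl : x = b := eq_of_wordDist_eq_zero hS (by omega)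
    rw [wordDist_self, wordDist_comm hS, hxc, zero_add]

end IsBridge

end Atoms

section DoubleBridge

variable {H : Type} [Group H] {S : Set H}

/-- The edges at `1` labelled `t` and `t⁻¹` separate the Cayley graph, and the nontrivial
element `a` preserves on the right the side `Q` of the first one. -/
structure IsBridgePair (S : Set H) (t a : H) (Q : Set H) : Prop where
  closure_eq : Subgroup.closure S = ⊤
  finite : S.Finite
  bridge : IsBridge S t Q
  ne_one : a ≠ 1
  mul_mem_iff : ∀ x, x * a ∈ Q ↔ x ∈ Q

namespace IsBridgePair

variable {t a : H} {Q : Set H}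

theorem bridge_inv (hP : IsBridgePair S t a Q) : IsBridge S t⁻¹ {x | t * x ∉ Q} :=
  hP.bridge.inv hP.closure_eq

theorem mul_inv_mem_iff (hP : IsBridgePair S t a Q) (x : H) : x * a⁻¹ ∈ Q ↔ x ∈ Q := by
  rw [← hP.mul_mem_iff (x * a⁻¹), inv_mul_cancel_right]

theorem notMem (hP : IsBridgePair S t a Q) : a ∉ Q := by
  rw [← one_mul a, hP.mul_mem_iff]
  exact hP.bridge.one_notMem

theorem inv_notMem (hP : IsBridgePair S t a Q) : a⁻¹ ∉ Q := by
  rw [← one_mul a⁻¹, hP.mul_inv_mem_iff]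
  exact hP.bridge.one_notMem

theorem mul_mem (hP : IsBridgePair S t a Q) : t * a ∈ Q := by
  rw [hP.mul_mem_iff]
  exact hP.bridge.self_mem

theorem mul_inv_mem (hP : IsBridgePair S t a Q) : t * a⁻¹ ∈ Q := by
  rw [hP.mul_inv_mem_iff]
  exact hP.bridge.self_mem

/-- Left multiplication by `a⁻¹` takes both halfspaces out of both halfspaces. -/
theorem inv_mul_notMem (hP : IsBridgePair S t a Q) {z : H} (hz : z ∈ Q ∨ t * z ∉ Q) :
    a⁻¹ * z ∉ Q ∧ t * (a⁻¹ * z) ∈ Q := by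
  have ha : a⁻¹ ≠ 1 := inv_ne_one.2 hP.ne_one
  have hS := hP.closure_eq
  have h1 : a⁻¹⁻¹ ∉ Q := by simpa using hP.notMem
  have h2 : a⁻¹⁻¹ ∉ {x | t * x ∉ Q} := by simpa using hP.mul_mem
  have h3 : a⁻¹ ∉ {x | t * x ∉ Q} := by simpa using hP.mul_inv_mem
  rcases hz with hz | hz
  · refine ⟨hP.bridge.disjoint_translate hS hP.bridge ha h1 hP.inv_notMem hz, ?_⟩
    simpa using hP.bridge.disjoint_translate hS hP.bridge_inv ha h1 h3 hz
  · refine ⟨hP.bridge_inv.disjoint_translate hS hP.bridge ha h2 hP.inv_notMem hz, ?_⟩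
    simpa using hP.bridge_inv.disjoint_translate hS hP.bridge_inv ha h2 h3 hz

/-- Every element can be replaced by one in the same atom, which is at least as long and
from which one can continue in both directions `t` and `t⁻¹`. -/
theorem exists_sameAtom (hP : IsBridgePair S t a Q) (x : H) :
    ∃ y, SameAtom S (wordDist S 1 x) x y ∧ wordDist S 1 x ≤ wordDist S 1 y ∧
      y⁻¹ ∉ Q ∧ t * y⁻¹ ∈ Q := by
  have hS := hP.closure_eq
  by_cases hx : x⁻¹ ∈ Q ∨ t * x⁻¹ ∉ Q
  · have hd : ∀ b, wordDist S 1 b ≤ wordDist S 1 x →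
        wordDist S (x * a) b = wordDist S x b + wordDist S 1 a := by
      intro b hb
      rcases hx with hx | hx
      · exact hP.bridge.dist_mul_of_inv_mem hS hx hP.notMem hb
      · exact hP.bridge_inv.dist_mul_of_inv_mem hS hx (by simpa using hP.mul_mem) hb
    refine ⟨x * a, sameAtom_of_forall_eq_add _ hd, ?_, ?_⟩
    · rw [wordDist_comm hS, wordDist_comm hS 1 (x * a), hd 1 (by simp [wordDist_self])]
      exact Nat.le_add_right _ _
    · rw [mul_inv_rev]
      exact hP.inv_mul_notMem hx
  · rw [not_or, not_not] at hx
    exact ⟨x, SameAtom.refl _ _, le_rfl, hx⟩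

theorem exists_mem_atom (hP : IsBridgePair S t a Q) {n : ℕ} {A : Set H}
    (hA : A ∈ InfAtoms S n) :
    ∃ x ∈ A, n ≤ wordDist S 1 x ∧ x⁻¹ ∉ Q ∧ t * x⁻¹ ∈ Q := by
  obtain ⟨x, hxA, hx⟩ := exists_mem_le_wordDist hP.closure_eq hP.finite hA.2 n
  obtain ⟨y, hxy, hle, hy⟩ := hP.exists_sameAtom x
  exact ⟨y, atomOf_subset hx hA hxA hxy, hx.trans hle, hy⟩

end IsBridgePair

end DoubleBridge

section Boundary

variable {H : Type} [Group H] {S : Set H}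

theorem mk_eq_mk_iff {f h : H → ℤ} :
    (QuotientAddGroup.mk f : FBar H) = QuotientAddGroup.mk h ↔
      ∀ x y, f x - f y = h x - h y := by
  rw [QuotientAddGroup.eq]
  constructor
  · rintro ⟨c, hc⟩ x y
    have hx := hc x
    have hy := hc y
    simp only [Pi.add_apply, Pi.neg_apply] at hx hy
    omega
  · intro hfh
    refine ⟨h 1 - f 1, fun y => ?_⟩
    have := hfh y 1
    simp only [Pi.add_apply, Pi.neg_apply]
    omega

/-- Every boundary point is represented on each ball by elements outside of that ball. -/
theorem exists_mem_atom_of_mem_horoBoundary (hS : Subgroup.closure S = ⊤)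
    (hfin : S.Finite) {f : H → ℤ} (hf : (QuotientAddGroup.mk f : FBar H) ∈ horoBoundary S)
    (n : ℕ) :
    ∃ x, n ≤ wordDist S 1 x ∧ ∀ b, wordDist S 1 b ≤ n →
      f b - wordDist S x b = f 1 - wordDist S x 1 := by
  have approx : ∀ m, ∃ x, dbar S x ≠ QuotientAddGroup.mk f ∧ ∀ b, wordDist S 1 b ≤ m →
      f b - wordDist S x b = f 1 - wordDist S x 1 := by
    intro m
    have hopen : IsOpen ((ball S m).pi fun b => ({f b} : Set ℤ)) :=
      isOpen_set_pi (finite_ball hS hfin m) fun _ _ => isOpen_discrete _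
    have := mem_closure_iff.1 hf _ (QuotientAddGroup.isOpenMap_coe _ hopen)
      ⟨f, fun b _ => rfl, rfl⟩
    obtain ⟨_, ⟨h, hh, hhx⟩, ⟨x, rfl⟩, hne⟩ := this
    refine ⟨x, hne, fun b hb => ?_⟩
    have e1 := mk_eq_mk_iff.1 hhx b 1
    have e2 : h b = f b := hh b (mem_ball_iff.2 hb)
    have e3 : h 1 = f 1 := hh 1 (mem_ball_iff.2 (by simp [wordDist_self]))
    omega
  obtain ⟨x, hne, hx⟩ := approx n
  by_cases hxn : n ≤ wordDist S 1 x
  · exact ⟨x, hxn, hx⟩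
  exfalso
  refine hne (mk_eq_mk_iff.2 ?_)
  have key : ∀ b, f b - wordDist S x b = f 1 - wordDist S x 1 := by
    intro b
    obtain ⟨y, -, hy⟩ := approx (n + wordDist S 1 b)
    have hyx : x = y := by
      by_contra hxy
      obtain ⟨s, hs, hd⟩ := exists_adjacent_closer hS hxy
      have e1 := wordDist_mul_right_le_one hs x
      have e2 := wordDist_triangle hS 1 x (x * s)
      have e3 := hx x (by omega)
      have e4 := hx (x * s) (by omega)
      have e5 := hy x (by omega)
      have e6 := hy (x * s) (by omega)
      rw [wordDist_self] at e3
      rw [wordDist_comm hS _ y, wordDist_comm hS _ y] at hd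
      omega
    subst hyx
    exact hy b (by omega)
  intro b c
  have e1 := key b
  have e2 := key c
  omega

/-- The horofunction of the ray `x, x * u, x * u ^ 2, …`. -/
def rayHorofunction (S : Set H) (x u : H) (b : H) : ℤ :=
  wordDist S (x * u ^ wordDist S 1 b) b - wordDist S 1 b

namespace IsBridge

variable {u : H} {T : Set H}

theorem dist_ray (hS : Subgroup.closure S = ⊤) (hB : IsBridge S u T) {x b : H}
    (hx : x⁻¹ ∉ T) {k : ℕ} (hb : wordDist S 1 b ≤ wordDist S 1 x + k) (j : ℕ) :
    wordDist S (x * u ^ (k + j)) b = wordDist S (x * u ^ k) b + j := by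
  induction j with
  | zero => rfl
  | succ j ih =>
    have hle : wordDist S 1 b ≤ wordDist S 1 (x * u ^ (k + j)) := by
      rw [hB.dist_one_mul_pow hS hx]
      omega
    have hx' := hB.inv_mul_pow_notMem hS hx (k + j)
    rw [← add_assoc, pow_succ, ← mul_assoc,
      hB.dist_translate_tip (hB.notMem_of_dist_le hS hx' hle), ih]
    ring

theorem rayHorofunction_eq (hS : Subgroup.closure S = ⊤) (hB : IsBridge S u T) {x b : H}
    (hx : x⁻¹ ∉ T) {k : ℕ} (hb : wordDist S 1 b ≤ wordDist S 1 x + k) :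
    rayHorofunction S x u b = wordDist S (x * u ^ k) b - k := by
  rw [rayHorofunction]
  rcases le_total k (wordDist S 1 b) with h | h
  · obtain ⟨j, hj⟩ := Nat.exists_eq_add_of_le h
    have e := hB.dist_ray hS hx hb j
    rw [hj, e]
    push_cast
    ring
  · obtain ⟨j, hj⟩ := Nat.exists_eq_add_of_le h
    have e := hB.dist_ray hS hx (k := wordDist S 1 b) (b := b) (by omega) j
    rw [hj, e]
    push_cast
    ring

theorem rayHorofunction_tip (hS : Subgroup.closure S = ⊤) (hB : IsBridge S u T) {x : H}
    (hx : x⁻¹ ∉ T) (k : ℕ) :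
    rayHorofunction S x u (x * u ^ (k + 1)) = rayHorofunction S x u (x * u ^ k) - 1 := by
  have e1 := hB.dist_one_mul_pow hS hx k
  have e2 := hB.dist_one_mul_pow hS hx (k + 1)
  rw [hB.rayHorofunction_eq hS hx e2.le, hB.rayHorofunction_eq hS hx e1.le, wordDist_self,
    wordDist_self]
  push_cast
  ring

theorem rayHorofunction_mem (hS : Subgroup.closure S = ⊤) (hB : IsBridge S u T) {x : H}
    (hx : x⁻¹ ∉ T) : (QuotientAddGroup.mk (rayHorofunction S x u) : FBar H) ∈
      horoBoundary S := by
  have hlim : Filter.Tendsto (fun (k : ℕ) (b : H) => (wordDist S (x * u ^ k) b : ℤ) - k)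
      Filter.atTop (nhds (rayHorofunction S x u)) := by
    refine tendsto_pi_nhds.2 fun b => tendsto_const_nhds.congr' ?_
    filter_upwards [Filter.eventually_ge_atTop (wordDist S 1 b)] with k hk
    exact hB.rayHorofunction_eq hS hx (by omega)
  have hmk : Continuous (QuotientAddGroup.mk : (H → ℤ) → FBar H) := continuous_quot_mk
  refine mem_closure_of_tendsto ((hmk.tendsto _).comp hlim)
    (Filter.Eventually.of_forall fun k => ?_)
  have hdbar : dbar S (x * u ^ k) =
      QuotientAddGroup.mk (fun b => (wordDist S (x * u ^ k) b : ℤ) - k) :=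
    mk_eq_mk_iff.2 fun b c => by ring
  refine ⟨⟨_, hdbar⟩, fun heq => ?_⟩
  have e := mk_eq_mk_iff.1 heq (x * u ^ (k + 1)) (x * u ^ k)
  rw [hB.rayHorofunction_tip hS hx] at e
  simp only [wordDist_self] at e
  omega

theorem boundaryAct_ne (hS : Subgroup.closure S = ⊤)
    (hB : IsBridge S u T) {x g : H} (hx : x⁻¹ ∉ T) (hg : g ≠ 1)
    (hg1 : x⁻¹ * g * x ∉ T) (hg2 : x⁻¹ * g⁻¹ * x ∉ T) :
    boundaryAct g (QuotientAddGroup.mk (rayHorofunction S x u) : FBar H) ≠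
      QuotientAddGroup.mk (rayHorofunction S x u) := by
  intro heq
  have heq' : (QuotientAddGroup.mk (fun y => rayHorofunction S x u (g⁻¹ * y)) : FBar H) =
      QuotientAddGroup.mk (rayHorofunction S x u) := heq
  have e := mk_eq_mk_iff.1 heq' (x * u) x
  have e1 := hB.rayHorofunction_tip hS hx 0
  simp only [pow_zero, zero_add, pow_one, mul_one] at e1
  let k := wordDist S 1 (g⁻¹ * (x * u)) + wordDist S 1 (g⁻¹ * x)
  rw [hB.rayHorofunction_eq hS hx (b := g⁻¹ * (x * u)) (k := k + 1) (by omega),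
    hB.rayHorofunction_eq hS hx (b := g⁻¹ * x) (k := k + 1) (by omega), e1] at e
  have hc : x⁻¹ * g * x ≠ 1 := fun h =>
    hg ((conj_eq_one_iff (a := x⁻¹)).1 (by rwa [inv_inv]))
  have hdis := hB.disjoint_translate hS hB hc
    (by simpa [mul_assoc] using hg2) hg1 (hB.pow_mem hS k)
  have e2 := hB.dist_translate_tip (x := g⁻¹ * x) (b := x * u ^ (k + 1))
    (by simpa [mul_assoc] using hdis)
  rw [mul_assoc, wordDist_comm hS, wordDist_comm hS (g⁻¹ * x)] at e2
  omega

end IsBridge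

namespace IsBridgePair

variable {t a : H} {Q : Set H}

theorem not_isOpen_singleton (hP : IsBridgePair S t a Q) (φ : ↥(horoBoundary S)) :
    ¬IsOpen ({φ} : Set ↥(horoBoundary S)) := by
  have hS := hP.closure_eq
  obtain ⟨φ, hφ⟩ := φ
  intro hopen
  obtain ⟨U, hU, hUφ⟩ := isOpen_induced_iff.1 hopen
  have huniq : ∀ ψ ∈ horoBoundary S, ψ ∈ U → ψ = φ := by
    intro ψ hψ hψU
    have : (⟨ψ, hψ⟩ : ↥(horoBoundary S)) ∈ ({⟨φ, hφ⟩} : Set ↥(horoBoundary S)) := by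
      rw [← hUφ]
      exact hψU
    exact congrArg Subtype.val this
  have hφU : φ ∈ U := by
    have : (⟨φ, hφ⟩ : ↥(horoBoundary S)) ∈ Subtype.val ⁻¹' U := by
      rw [hUφ]
      rfl
    exact this
  obtain ⟨f, rfl⟩ := QuotientAddGroup.mk_surjective φ
  have hmk : Continuous (QuotientAddGroup.mk : (H → ℤ) → FBar H) := continuous_quot_mk
  obtain ⟨I, v, hv, hIv⟩ := isOpen_pi_iff.1 (hU.preimage hmk) f hφU
  let n := I.sup (wordDist S 1)
  obtain ⟨x, hxn, hx⟩ :=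
    exists_mem_atom_of_mem_horoBoundary hS hP.finite hφ n
  obtain ⟨y, hxy, hle, hy⟩ := hP.exists_sameAtom x
  have agree : ∀ {u : H} {T : Set H}, IsBridge S u T → y⁻¹ ∉ T →
      (QuotientAddGroup.mk (rayHorofunction S y u) : FBar H) = QuotientAddGroup.mk f := by
    intro u T hB hyT
    refine huniq _ (hB.rayHorofunction_mem hS hyT) ?_
    have hmem : (fun b => rayHorofunction S y u b +
        (f 1 - rayHorofunction S y u 1)) ∈ (I : Set H).pi v := by
      intro b hb
      have hbn : wordDist S 1 b ≤ n := Finset.le_sup (f := wordDist S 1) hb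
      have e0 := sameAtom_iff.1 hxy b (by omega)
      have e1 := hx b hbn
      have e2 := hB.rayHorofunction_eq hS hyT (b := b) (k := 0) (by omega)
      have e3 := hB.rayHorofunction_eq hS hyT (b := 1) (k := 0) (by simp [wordDist_self])
      rw [pow_zero, mul_one] at e2 e3
      have : rayHorofunction S y u b + (f 1 - rayHorofunction S y u 1) = f b := by
        omega
      simp only [this]
      exact (hv b hb).2
    have hU' := hIv hmem
    rw [Set.mem_preimage] at hU'
    convert hU' using 1
    exact mk_eq_mk_iff.2 fun b c => by ring
  have h1 := agree hP.bridge hy.1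
  have h2 := agree hP.bridge_inv (by simpa using hy.2)
  have e := mk_eq_mk_iff.1 (h1.trans h2.symm) (y * t) y
  have e1 := hP.bridge.rayHorofunction_tip hS hy.1 0
  have hlen := hP.bridge.dist_one_mul hS hy.1
  have hy2 : y⁻¹ ∉ {x | t * x ∉ Q} := by simpa using hy.2
  have e2 := hP.bridge_inv.rayHorofunction_eq hS hy2 (k := 1) hlen.le
  have e3 := hP.bridge_inv.rayHorofunction_eq hS hy2 (k := 1) (b := y) (by omega)
  have e4 : wordDist S (y * t⁻¹) y = 1 := by
    have := hP.bridge_inv.dist_translate_tip (x := y) (b := y)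
      (by simpa using hP.bridge.self_mem)
    rwa [wordDist_self] at this
  simp only [pow_zero, zero_add, pow_one, mul_one] at e1 e2 e3
  have h0 : wordDist S (y * t⁻¹) (y * t) = 0 := by omega
  have htt := mul_left_cancel (eq_of_wordDist_eq_zero hS h0)
  refine hP.bridge.one_notMem ?_
  have := hP.bridge.mul_self_mem
  nth_rewrite 1 [← htt] at this
  rwa [inv_mul_cancel] at this

theorem exists_boundaryAct_ne (hP : IsBridgePair S t a Q) {g : H} (hg : g ≠ 1) :
    ∃ ψ ∈ horoBoundary S, boundaryAct g ψ ≠ ψ := by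
  have hS := hP.closure_eq
  have h1 : (1 : H)⁻¹ ∉ Q := by simpa using hP.bridge.one_notMem
  by_cases hQ : g ∉ Q ∧ g⁻¹ ∉ Q
  · exact ⟨_, hP.bridge.rayHorofunction_mem hS h1, hP.bridge.boundaryAct_ne hS h1 hg
      (by simpa using hQ.1) (by simpa using hQ.2)⟩
  by_cases hQ' : t * g ∈ Q ∧ t * g⁻¹ ∈ Q
  · have h1' : (1 : H)⁻¹ ∉ {x | t * x ∉ Q} := by simpa using hP.bridge.self_mem
    exact ⟨_, hP.bridge_inv.rayHorofunction_mem hS h1', hP.bridge_inv.boundaryAct_ne hS h1' hg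
      (by simpa using hQ'.1) (by simpa using hQ'.2)⟩
  have hsub : ∀ z ∈ Q, t * z ∈ Q := fun z hz => hP.bridge.mul_mem hS hz
  have h2 : (g ∈ Q ∨ t * g ∉ Q) ∧ (g⁻¹ ∈ Q ∨ t * g⁻¹ ∉ Q) := by
    have := hsub g
    have := hsub g⁻¹
    tauto
  refine ⟨_, hP.bridge.rayHorofunction_mem hS hP.inv_notMem, hP.bridge.boundaryAct_ne hS
    hP.inv_notMem hg ?_ ?_⟩
  · rw [hP.mul_mem_iff]
    exact (hP.inv_mul_notMem h2.1).1
  · rw [hP.mul_mem_iff]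
    exact (hP.inv_mul_notMem h2.2).1

end IsBridgePair

end Boundary

section TypeGraph

variable {H : Type} [Group H] {S : Set H}

theorem AtomIdx.ext {p q : AtomIdx S} (h1 : p.1 = q.1) (h2 : p.2.1 = q.2.1) : p = q := by
  obtain ⟨n, A, hA⟩ := p
  obtain ⟨m, B, hB⟩ := q
  obtain rfl : n = m := h1
  obtain rfl : A = B := h2
  rfl

theorem finite_setOf_level_eq (hS : Subgroup.closure S = ⊤) (hfin : S.Finite) (n : ℕ) :
    {q : AtomIdx S | q.1 = n}.Finite := by
  refine Set.Finite.of_finite_image (f := fun q => q.2.1)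
    ((finite_atoms hS hfin n).subset ?_) ?_
  · rintro _ ⟨q, rfl, rfl⟩
    obtain ⟨x, hx⟩ := q.2.2.1
    exact ⟨x, hx.symm⟩
  · rintro p rfl q hq h
    exact AtomIdx.ext hq.symm h

/-- The children of an atom that have a given image under `τ`. -/
def childrenWith {V : Type} (τ : AtomIdx S → V) (p : AtomIdx S) (w : V) : Set (AtomIdx S) :=
  {q | q.1 = p.1 + 1 ∧ q.2.1 ⊆ p.2.1 ∧ τ q = w}

theorem finite_childrenWith (hS : Subgroup.closure S = ⊤) (hfin : S.Finite) {V : Type}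
    (τ : AtomIdx S → V) (p : AtomIdx S) (w : V) : (childrenWith τ p w).Finite :=
  (finite_setOf_level_eq hS hfin (p.1 + 1)).subset fun _ hq => hq.1

/-- The equivalence relation of having the same type. -/
def typeSetoid (hS : Subgroup.closure S = ⊤) (hfin : S.Finite) : Setoid (AtomIdx S) where
  r := SameTypeIdx S
  iseqv :=
    { refl := fun p => ⟨1, IsMorphism.refl p⟩
      symm := fun {p _} ⟨_, hg⟩ => ⟨_, hg.inv hS hfin p.2.2⟩
      trans := fun ⟨_, hg⟩ ⟨_, hg'⟩ => ⟨_, hg.trans hg'⟩ }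

theorem ncard_childrenWith_le (hS : Subgroup.closure S = ⊤) (hfin : S.Finite)
    {V : Type} {τ : AtomIdx S → V} (hτ : ∀ p q, SameTypeIdx S p q → τ p = τ q)
    {p p' : AtomIdx S} (h : SameTypeIdx S p p') (w : V) :
    (childrenWith τ p w).ncard ≤ (childrenWith τ p' w).ncard := by
  obtain ⟨g, hg⟩ := h
  have hmem : ∀ q ∈ childrenWith τ p w, (g * ·) '' q.2.1 ∈ InfAtoms S (p'.1 + 1) ∧
      (g * ·) '' q.2.1 ⊆ p'.2.1 := by
    intro q hq
    exact hg.2.2 1 one_pos q.2.1 (hq.1 ▸ q.2.2) hq.2.1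
  let f : AtomIdx S → AtomIdx S := fun q =>
    if h : (g * ·) '' q.2.1 ∈ InfAtoms S (p'.1 + 1) then ⟨p'.1 + 1, _, h⟩ else q
  have hf : ∀ q ∈ childrenWith τ p w, ∃ h, f q = ⟨p'.1 + 1, (g * ·) '' q.2.1, h⟩ :=
    fun q hq => ⟨(hmem q hq).1, dif_pos (hmem q hq).1⟩
  refine Set.ncard_le_ncard_of_injOn f ?_ ?_ (finite_childrenWith hS hfin τ p' w)
  · intro q hq
    obtain ⟨h, hfq⟩ := hf q hq
    rw [hfq]
    refine ⟨rfl, (hmem q hq).2, ?_⟩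
    rw [← hq.2.2]
    refine (hτ _ _ ⟨g, ?_⟩).symm
    have := hg.restrict hq.2.1
    rwa [← hq.1] at this
  · intro q hq q' hq' heq
    obtain ⟨h, hfq⟩ := hf q hq
    obtain ⟨h', hfq'⟩ := hf q' hq'
    rw [hfq, hfq'] at heq
    have himg : (g * ·) '' q.2.1 = (g * ·) '' q'.2.1 :=
      congrArg (fun r : AtomIdx S => r.2.1) heq
    exact AtomIdx.ext (hq.1.trans hq'.1.symm) ((mul_right_injective g).image_injective himg)

theorem exists_isTypeGraph (hS : Subgroup.closure S = ⊤) (hfin : S.Finite)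
    (hT : FinitelyManyTypes S) :
    ∃ (Δ : FinDigraph) (τ : AtomIdx S → Δ.V), IsTypeGraph S Δ τ := by
  let V := Quotient (typeSetoid hS hfin)
  let τ : AtomIdx S → V := Quotient.mk _
  have hτ : ∀ p q, τ p = τ q ↔ SameTypeIdx S p q := fun p q => Quotient.eq
  have hV : Finite V := by
    obtain ⟨R, hR, hRp⟩ := hT
    have : (Set.univ : Set V).Finite := by
      refine (hR.image τ).subset fun v _ => ?_
      obtain ⟨p, rfl⟩ := Quotient.mk_surjective v
      obtain ⟨q, hq, hpq⟩ := hRp p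
      exact ⟨q, hq, ((hτ p q).2 hpq).symm⟩
    exact Set.finite_univ_iff.1 this
  have := Fintype.ofFinite V
  let cnt : V × V → ℕ := fun v => (childrenWith τ v.1.out v.2).ncard
  let Δ : FinDigraph := { V := V, E := Σ v, Fin (cnt v), o := fun e => e.1.1, t := fun e => e.1.2 }
  refine ⟨Δ, τ, Quotient.mk_surjective, hτ, fun p w => ?_⟩
  have hset : {e : Δ.E | Δ.o e = τ p ∧ Δ.t e = w} =
      Sigma.mk (β := fun v => Fin (cnt v)) (τ p, w) '' Set.univ := by
    ext ⟨⟨v, v'⟩, i⟩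
    constructor
    · rintro ⟨h1, h2⟩
      obtain rfl : v = τ p := h1
      obtain rfl : v' = w := h2
      exact ⟨i, trivial, rfl⟩
    · rintro ⟨j, -, hj⟩
      have := congrArg Sigma.fst hj
      exact ⟨(congrArg Prod.fst this).symm, (congrArg Prod.snd this).symm⟩
  rw [hset, Set.ncard_image_of_injective _ sigma_mk_injective, Set.ncard_univ, Nat.card_fin]
  have hp : SameTypeIdx S p (τ p).out := (hτ _ _).1 (Quotient.out_eq (τ p)).symm
  exact le_antisymm
    (ncard_childrenWith_le hS hfin (fun p q => (hτ p q).2) hp w)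
    (ncard_childrenWith_le hS hfin (fun p q => (hτ p q).2)
      ((typeSetoid hS hfin).symm hp) w)

namespace IsTypeGraph

variable {Δ : FinDigraph} {τ : AtomIdx S → Δ.V}

theorem exists_edge (hS : Subgroup.closure S = ⊤) (hfin : S.Finite)
    (hΔ : IsTypeGraph S Δ τ) {p q : AtomIdx S} (h1 : q.1 = p.1 + 1)
    (h2 : q.2.1 ⊆ p.2.1) : ∃ e, Δ.o e = τ p ∧ Δ.t e = τ q := by
  refine Set.nonempty_of_ncard_ne_zero (s := {e | Δ.o e = τ p ∧ Δ.t e = τ q}) ?_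
  rw [← hΔ.2.2]
  exact (Set.ncard_pos (finite_childrenWith hS hfin τ p (τ q))).2 ⟨q, h1, h2, rfl⟩ |>.ne'

theorem exists_child_of_edge (hΔ : IsTypeGraph S Δ τ) {p : AtomIdx S} {e : Δ.E}
    (he : Δ.o e = τ p) : ∃ q : AtomIdx S, q.1 = p.1 + 1 ∧ τ q = Δ.t e := by
  have hpos : 0 < {e' | Δ.o e' = τ p ∧ Δ.t e' = Δ.t e}.ncard :=
    (Set.ncard_pos (Set.toFinite _)).2 ⟨e, he, rfl⟩
  rw [← hΔ.2.2] at hpos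
  obtain ⟨q, hq⟩ := Set.nonempty_of_ncard_ne_zero hpos.ne'
  exact ⟨q, hq.1, hq.2.2⟩

/-- Distinct children of an atom give distinct edges. -/
theorem eq_of_existsUnique_edge (hS : Subgroup.closure S = ⊤) (hfin : S.Finite)
    (hΔ : IsTypeGraph S Δ τ) {p q r : AtomIdx S} (hq : q.1 = p.1 + 1)
    (hqp : q.2.1 ⊆ p.2.1) (hr : r.1 = p.1 + 1) (hrp : r.2.1 ⊆ p.2.1)
    (huniq : ∀ e e' : Δ.E, Δ.o e = τ p → Δ.o e' = τ p → e = e') : q = r := by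
  obtain ⟨e, he, heq⟩ := hΔ.exists_edge hS hfin hq hqp
  obtain ⟨e', he', heq'⟩ := hΔ.exists_edge hS hfin hr hrp
  have hτ : τ r = τ q := by rw [← heq, ← heq', huniq e e' he he']
  have hcard : (childrenWith τ p (τ q)).ncard ≤ 1 := by
    refine (hΔ.2.2 p (τ q)).le.trans ?_
    rw [Set.ncard_le_one (Set.toFinite _)]
    exact fun a ha b hb => huniq a b ha.1 hb.1
  rw [Set.ncard_le_one (finite_childrenWith hS hfin τ p (τ q))] at hcard
  exact hcard q ⟨hq, hqp, rfl⟩ r ⟨hr, hrp, hτ⟩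

/-- The types of the atoms at positive levels. -/
def core (τ : AtomIdx S → Δ.V) : Set Δ.V := {v | ∃ q : AtomIdx S, τ q = v ∧ 1 ≤ q.1}

theorem target_mem_core (hΔ : IsTypeGraph S Δ τ) (e : Δ.E) : Δ.t e ∈ core τ := by
  obtain ⟨p, hp⟩ := hΔ.1 (Δ.o e)
  obtain ⟨q, hq, hqe⟩ := hΔ.exists_child_of_edge hp.symm
  exact ⟨q, hqe, by omega⟩

theorem exists_path (hS : Subgroup.closure S = ⊤) (hfin : S.Finite)
    (hΔ : IsTypeGraph S Δ τ) (k : ℕ) {p q : AtomIdx S} (hp : τ p ∈ core τ)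
    (h1 : q.1 = p.1 + k) (h2 : q.2.1 ⊆ p.2.1) :
    ∃ l : List Δ.E, l.length = k ∧ Δ.pathOk (τ p) l ∧ Δ.pathEndAux (τ p) l = τ q ∧
      ∀ e ∈ l, Δ.InducedEdge (core τ) e := by
  induction k generalizing p with
  | zero =>
    obtain ⟨x, hx⟩ := q.2.2.2.nonempty
    have hqp : q = p := by
      refine AtomIdx.ext h1 (atoms_eq_of_not_disjoint q.2.2 ?_ hx (h2 hx))
      rw [h1]
      exact p.2.2
    exact ⟨[], rfl, trivial, by rw [hqp]; rfl, by simp⟩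
  | succ k ih =>
    obtain ⟨x, hx⟩ := q.2.2.2.nonempty
    have hqc : q.2.1 ⊆ atomOf S (p.1 + 1) x := by
      rw [eq_atomOf_of_mem q.2.2 hx]
      exact fun y hy => SameAtom.mono (by omega) hy
    let c : AtomIdx S := ⟨p.1 + 1, atomOf S (p.1 + 1) x, ⟨x, rfl⟩, q.2.2.2.mono hqc⟩
    obtain ⟨e, heo, het⟩ := hΔ.exists_edge hS hfin (p := p) (q := c) rfl
      (atomOf_subset (Nat.le_succ _) p.2.2 (h2 hx))
    have hc : τ c ∈ core τ := ⟨c, rfl, Nat.le_add_left 1 p.1⟩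
    obtain ⟨l, hl, hok, hend, hind⟩ := ih (p := c) hc (by rw [h1, add_right_comm]; rfl) hqc
    refine ⟨e :: l, by simp [hl], ⟨heo, het ▸ hok⟩, ?_, ?_⟩
    · rw [FinDigraph.pathEndAux, het, hend]
    · intro e' he'
      rcases List.mem_cons.1 he' with rfl | he'
      · exact ⟨heo ▸ hp, het ▸ hc⟩
      · exact hind e' he'

end IsTypeGraph

namespace IsBridgePair

variable {t a : H} {Q : Set H}

/-- Every type of atoms at a positive level occurs among the descendants of every atom. -/
theorem exists_descendant (hP : IsBridgePair S t a Q) (p r : AtomIdx S) (hr : 1 ≤ r.1) :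
    ∃ q : AtomIdx S, p.1 < q.1 ∧ q.2.1 ⊆ p.2.1 ∧ SameTypeIdx S r q := by
  have hS := hP.closure_eq
  obtain ⟨x, hxp, hxn, hx⟩ := hP.exists_mem_atom p.2.2
  have descend : ∀ {u : H} {T : Set H}, IsBridge S u T → x⁻¹ ∉ T →
      (∀ y ∈ r.2.1, u * y ∈ T) →
      ∃ q : AtomIdx S, p.1 < q.1 ∧ q.2.1 ⊆ p.2.1 ∧ SameTypeIdx S r q := by
    intro u T hB hxT hrT
    refine ⟨⟨_, _, hB.image_mem_infAtoms hS hxT r.2.2 hrT⟩, ?_, ?_, x * u,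
      hB.isMorphism_image hS hxT hrT⟩
    · exact Nat.lt_of_lt_of_le (Nat.lt_succ_of_le hxn) (Nat.le_add_right _ _)
    · rintro _ ⟨y, hy, rfl⟩
      simp only [mul_assoc]
      exact hB.mul_mem_atom hS p.2.2 hxp hxn hxT (hrT y hy)
  by_cases hrQ : ∃ y ∈ r.2.1, y ∈ Q
  · obtain ⟨y, hy, hyQ⟩ := hrQ
    refine descend hP.bridge hx.1 fun z hz => hP.bridge.mul_mem hS ?_
    rw [eq_atomOf_of_mem r.2.2 hy] at hz
    have := hP.bridge.mem_of_sameAtom hS (x := 1) (y := y) (z := z) (n := r.1)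
      (by simpa [wordDist_self] using hr) (by simpa using hP.bridge.one_notMem)
      (by simpa using hyQ) hz
    simpa using this
  · refine descend hP.bridge_inv (by simpa using hx.2) fun z hz => ?_
    simpa using fun hzQ => hrQ ⟨z, hz, hzQ⟩

/-- Some atom at a positive level has two distinct infinite children. -/
theorem exists_two_children (hP : IsBridgePair S t a Q) :
    ∃ p q r : AtomIdx S, 1 ≤ p.1 ∧ q.1 = p.1 + 1 ∧ q.2.1 ⊆ p.2.1 ∧ r.1 = p.1 + 1 ∧
      r.2.1 ⊆ p.2.1 ∧ q ≠ r := by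
  have hS := hP.closure_eq
  have ha : 1 ≤ wordDist S 1 a := by
    by_contra h
    exact hP.ne_one (eq_of_wordDist_eq_zero hS (y := a) (x := 1) (by omega)).symm
  have haQ := hP.inv_notMem
  have haQ' : a⁻¹ ∉ {x | t * x ∉ Q} := by simpa using hP.mul_inv_mem
  have hatom : ∀ {u : H} {T : Set H}, IsBridge S u T → a⁻¹ ∉ T →
      atomOf S (wordDist S 1 a + 1) (a * u) ∈ InfAtoms S (wordDist S 1 a + 1) := by
    intro u T hB hT
    refine ⟨⟨_, rfl⟩, ((hB.infinite hS).image (mul_right_injective (a * u)).injOn).mono ?_⟩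
    rintro _ ⟨z, hz, rfl⟩
    have hlen := hB.dist_one_mul hS hT
    have h := hB.sameAtom_mul hS (x := a * u)
      (by rw [mul_inv_rev]; exact hB.inv_mul_notMem hS hT) hz
    rwa [hlen] at h
  have hsub : ∀ {u : H} {T : Set H}, IsBridge S u T → a⁻¹ ∉ T →
      atomOf S (wordDist S 1 a + 1) (a * u) ⊆ atomOf S (wordDist S 1 a) a := by
    intro u T hB hT y hy
    exact (hB.sameAtom_mul hS hT hB.self_mem).trans (SameAtom.mono (Nat.le_succ _) hy)
  have h1 := hatom hP.bridge haQ
  have h2 := hatom hP.bridge_inv haQ'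
  have h3 := hsub hP.bridge haQ
  refine ⟨⟨wordDist S 1 a, atomOf S (wordDist S 1 a) a, ⟨a, rfl⟩, h1.2.mono h3⟩, ⟨_, _, h1⟩,
    ⟨_, _, h2⟩, ha, rfl, h3, rfl, hsub hP.bridge_inv haQ', fun h => ?_⟩
  have heq : atomOf S (wordDist S 1 a + 1) (a * t) =
      atomOf S (wordDist S 1 a + 1) (a * t⁻¹) :=
    congrArg (fun r : AtomIdx S => r.2.1) h
  have hmem : a * t⁻¹ ∈ atomOf S (wordDist S 1 a + 1) (a * t) := by
    rw [heq]
    exact mem_atomOf_self _ _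
  have h4 := hP.bridge.mem_of_sameAtom hS le_rfl haQ (by simpa using hP.bridge.self_mem) hmem
  have h5 := hP.bridge.mul_mem hS h4
  simp only [inv_mul_cancel_left, mul_inv_cancel] at h5
  exact hP.bridge.one_notMem h5

theorem hasIrreducibleCore (hP : IsBridgePair S t a Q) {Δ : FinDigraph}
    {τ : AtomIdx S → Δ.V} (hΔ : IsTypeGraph S Δ τ) : Δ.HasIrreducibleCore := by
  have hS := hP.closure_eq
  refine ⟨IsTypeGraph.core τ, ⟨?_, ?_⟩, ?_, 1, ?_⟩
  · rintro _ ⟨p, rfl, hp⟩ _ ⟨r, rfl, hr⟩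
    obtain ⟨q, hlt, hsub, hrq⟩ := hP.exists_descendant p r hr
    have hpc : τ p ∈ IsTypeGraph.core τ := ⟨p, rfl, hp⟩
    obtain ⟨l, hl, hok, hend, hind⟩ := hΔ.exists_path hS hP.finite (q.1 - p.1) hpc
      (by omega) hsub
    refine ⟨⟨τ p, l, hok⟩, rfl, hend.trans ((hΔ.2.1 r q).2 hrq).symm, ?_, hpc, hind⟩
    rintro rfl
    simp only [List.length_nil] at hl
    omega
  · intro huniq
    obtain ⟨p, q, r, hp, hq, hqp, hr, hrp, hne⟩ := hP.exists_two_children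
    have hpc : τ p ∈ IsTypeGraph.core τ := ⟨p, rfl, hp⟩
    refine hne (hΔ.eq_of_existsUnique_edge hS hP.finite hq hqp hr hrp fun e e' he he' => ?_)
    exact (huniq _ hpc).unique ⟨⟨he ▸ hpc, hΔ.target_mem_core e⟩, he⟩
      ⟨⟨he' ▸ hpc, hΔ.target_mem_core e'⟩, he'⟩
  · intro v
    obtain ⟨p, rfl⟩ := hΔ.1 v
    obtain ⟨B, hB, hBp⟩ := exists_child hS hP.finite p.2.2
    obtain ⟨e, heo, -⟩ := hΔ.exists_edge hS hP.finite (p := p) (q := ⟨p.1 + 1, B, hB⟩) rfl hBp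
    exact ⟨⟨τ p, [e], heo, trivial⟩, rfl, hΔ.target_mem_core e⟩
  · rintro ⟨v, l, hok⟩ hl
    obtain ⟨e, rfl⟩ := List.length_eq_one_iff.1 hl
    exact hΔ.target_mem_core e

end IsBridgePair

end TypeGraph

section FreeProduct

variable (G : Type) [Group G]

/-- The permutation of `(G ∗ ℤ) × ℤ` by which `t` acts: its inverse multiplies by `t⁻¹` on
the left and counts the passages through `1`. -/
def tPerm : Equiv.Perm (FPZ G × ℤ) where
  toFun p := (tGen G * p.1, p.2 - if tGen G * p.1 = 1 then 1 else 0)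
  invFun p := ((tGen G)⁻¹ * p.1, p.2 + if p.1 = 1 then 1 else 0)
  left_inv p := by simp
  right_inv p := by simp

/-- The permutation of `(G ∗ ℤ) × ℤ` by which an element of `G` acts. -/
def inlPerm : G →* Equiv.Perm (FPZ G × ℤ) where
  toFun g :=
    { toFun := fun p => (Monoid.Coprod.inl g * p.1, p.2)
      invFun := fun p => ((Monoid.Coprod.inl g)⁻¹ * p.1, p.2)
      left_inv := fun p => by simp
      right_inv := fun p => by simp }
  map_one' := by
    ext p <;> simp
  map_mul' g h := by
    ext p <;> simp [mul_assoc]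

/-- The action of `G ∗ ℤ` on `(G ∗ ℤ) × ℤ` lifting left multiplication. -/
def countAct : FPZ G →* Equiv.Perm (FPZ G × ℤ) :=
  Monoid.Coprod.lift (inlPerm G) (zpowersHom _ (tPerm G))

variable {G}

theorem countAct_inl (g : G) (p : FPZ G × ℤ) :
    countAct G (Monoid.Coprod.inl g) p = (Monoid.Coprod.inl g * p.1, p.2) := by
  rw [countAct, Monoid.Coprod.lift_apply_inl]
  rfl

theorem countAct_tGen : countAct G (tGen G) = tPerm G := by
  rw [countAct, tGen, Monoid.Coprod.lift_apply_inr]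
  simp

theorem closure_fpGen {S : Set G} (hgen : Subgroup.closure S = ⊤) :
    Subgroup.closure (fpGen G S) = ⊤ := by
  rw [fpGen, Subgroup.closure_union, ← MonoidHom.map_closure, hgen, ← MonoidHom.range_eq_map,
    eq_top_iff, ← Monoid.Coprod.range_inl_sup_range_inr]
  refine sup_le_sup_left ?_ _
  rintro _ ⟨n, rfl⟩
  refine Subgroup.mem_closure_singleton.2 ⟨Multiplicative.toAdd n, ?_⟩
  rw [tGen, ← map_zpow, ← ofAdd_zsmul]
  simp

theorem countAct_fst (w : FPZ G) (p : FPZ G × ℤ) : (countAct G w p).1 = w * p.1 := by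
  have hw : w ∈ Subgroup.closure (fpGen G (Set.univ : Set G)) := by
    rw [closure_fpGen Subgroup.closure_univ]
    trivial
  induction hw using Subgroup.closure_induction generalizing p with
  | mem x hx =>
    rcases hx with ⟨g, -, rfl⟩ | rfl
    · rw [countAct_inl]
    · rw [countAct_tGen]
      rfl
  | one => simp
  | mul x y _ _ hx hy => rw [map_mul, Equiv.Perm.mul_apply, hx, hy, mul_assoc]
  | inv x _ hx =>
    have := hx (countAct G x⁻¹ p)
    rw [← Equiv.Perm.mul_apply, ← map_mul, mul_inv_cancel, map_one, Equiv.Perm.one_apply]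
      at this
    rw [this, inv_mul_cancel_left]

/-- The coefficient at `1` of the Fox derivative of `x` with respect to `t`. -/
def tCount (x : FPZ G) : ℤ := (countAct G x⁻¹ (1, 0)).2

theorem tCount_one : tCount (1 : FPZ G) = 0 := by simp [tCount]

theorem tCount_mul_inl (x : FPZ G) (g : G) :
    tCount (x * Monoid.Coprod.inl g) = tCount x := by
  rw [tCount, mul_inv_rev, map_mul, Equiv.Perm.mul_apply, ← map_inv, countAct_inl]
  rfl

theorem tCount_mul_tGen (x : FPZ G) :
    tCount (x * tGen G) = tCount x + if x = 1 then 1 else 0 := by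
  have h : ∀ p, (countAct G (tGen G)⁻¹ p).2 = p.2 + if p.1 = 1 then 1 else 0 := by
    intro p
    rw [map_inv, countAct_tGen]
    rfl
  rw [tCount, mul_inv_rev, map_mul, Equiv.Perm.mul_apply, h, countAct_fst, mul_one]
  simp [tCount]

theorem isBridge_tGen {S : Set G} (hgen : Subgroup.closure S = ⊤) :
    IsBridge (fpGen G S) (tGen G) {x | tCount x ≠ 0} := by
  have ht : tCount (tGen G) = 1 := by
    have := tCount_mul_tGen (1 : FPZ G)
    rwa [one_mul, if_pos rfl, tCount_one, zero_add] at this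
  refine isBridge_of_crossing (closure_fpGen hgen) (Or.inl (Or.inr rfl)) ?_ ?_ ?_ ?_
  · simp [tCount_one]
  · simp [ht]
  · simp only [Set.mem_ofPred_eq, tCount_mul_tGen, ht]
    split_ifs <;> decide
  · intro x s hs hx hxs
    simp only [Set.mem_ofPred_eq, not_not] at hx hxs
    rcases hs with (⟨g, -, rfl⟩ | rfl) | (⟨g, -, hg⟩ | hst)
    · exact absurd ((tCount_mul_inl x g).trans hx) hxs
    · rw [tCount_mul_tGen, hx, zero_add] at hxs
      by_cases h : x = 1
      · exact ⟨h, rfl⟩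
      · simp [h] at hxs
    · obtain rfl : s = Monoid.Coprod.inl g⁻¹ := by rw [map_inv, hg, inv_inv]
      exact absurd ((tCount_mul_inl x g⁻¹).trans hx) hxs
    · have hs : x * s * tGen G = x := by
        rw [← Set.mem_singleton_iff.1 hst, mul_inv_cancel_right]
      have e := tCount_mul_tGen (x * s)
      rw [hs, hx] at e
      by_cases h : x * s = 1
      · rw [h, tCount_one] at hxs
        exact absurd rfl hxs
      · rw [if_neg h, add_zero] at e
        exact absurd e.symm hxs

theorem isBridgePair_tGen {S : Set G} (hSfin : S.Finite) (hgen : Subgroup.closure S = ⊤)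
    {g : G} (hg : g ≠ 1) :
    IsBridgePair (fpGen G S) (tGen G) (Monoid.Coprod.inl g) {x | tCount x ≠ 0} where
  closure_eq := closure_fpGen hgen
  finite := (hSfin.image _).union (Set.finite_singleton _)
  bridge := isBridge_tGen hgen
  ne_one h := hg (Monoid.Coprod.inl_injective (h.trans (map_one _).symm))
  mul_mem_iff x := by simp only [Set.mem_ofPred_eq, tCount_mul_inl]

end FreeProduct

/-- For a non-trivial finitely generated group `G`, the horofunction boundary
`∂_h(G ∗ ℤ)` has no isolated points and `G ∗ ℤ` acts faithfully on it; moreover, if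
`G ∗ ℤ` has finitely many types of infinite atoms, then its type graph has an
irreducible core. -/
theorem free_product_with_Z_boundary (G : Type) [Group G] [Nontrivial G]
    (S : Set G) (hSfin : S.Finite) (hgen : Subgroup.closure S = ⊤) :
    (∀ φ : ↥(horoBoundary (fpGen G S)),
      ¬IsOpen ({φ} : Set ↥(horoBoundary (fpGen G S)))) ∧
    (∀ g : FPZ G, g ≠ 1 →
      ∃ ψ ∈ horoBoundary (fpGen G S), boundaryAct g ψ ≠ ψ) ∧
    (FinitelyManyTypes (fpGen G S) →
      ∃ (Δ : FinDigraph) (τ : AtomIdx (fpGen G S) → Δ.V),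
        IsTypeGraph (fpGen G S) Δ τ ∧ Δ.HasIrreducibleCore) := by
  obtain ⟨g, hg⟩ := exists_ne (1 : G)
  have hP := isBridgePair_tGen hSfin hgen hg
  refine ⟨hP.not_isOpen_singleton, fun g hg => hP.exists_boundaryAct_ne hg, fun hT => ?_⟩
  obtain ⟨Δ, τ, hΔ⟩ := exists_isTypeGraph hP.closure_eq hP.finite hT
  exact ⟨Δ, τ, hΔ, hP.hasIrreducibleCore hΔ⟩

end
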